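/- arXiv:2101.00104 — 6 statements merged into one kernel-verified Lean document; each statement's English description precedes it below -/
import Mathlib

section
/- Let 0 < b ≤ +∞ and let w, r : (0,b) → ℝ be measurable functions that are positive almost everywhere and integrable on (0,x) for every x ∈ (0,b), and assume w is integrable on (0,b). Set W(x) = ∫_0^x w(ξ) dξ for x ∈ [0,b] and R(x) = ∫_0^x r(ξ) dξ. If in addition ∫_0^b R(ξ) w(ξ) dξ < ∞, then lim_{x → b⁻} R(x)·(W(b) − W(x)) = 0. -/
open MeasureTheory Set Filter
open scoped ENNReal

/-- **Limit relation (4.48) in the proof of Proposition 4.25** (stated on the right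
half-interval `(0,b)` with `0 < b ≤ +∞`, the interval encoded as
`I = {x | 0 < x ∧ ofReal x < b}` for `b : ℝ≥0∞`): if `w` is integrable on `(0,b)` and
`∫₀ᵇ R(ξ) w(ξ) dξ < ∞`, then `R(x)·(W(b) - W(x)) → 0` as `x → b⁻` (the left limit at `b`
being taken along the filter `comap ofReal (𝓝[<] b) ⊓ 𝓟 I`). -/
theorem stmt_6 (b : ℝ≥0∞) (hb : 0 < b) (w r : ℝ → ℝ)
    (hwm : Measurable w) (hrm : Measurable r)
    (I : Set ℝ) (hI : I = {x : ℝ | 0 < x ∧ ENNReal.ofReal x < b})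
    (hwpos : ∀ᵐ x ∂(volume.restrict I), 0 < w x)
    (hrpos : ∀ᵐ x ∂(volume.restrict I), 0 < r x)
    (hwloc : ∀ x ∈ I, IntegrableOn w (Ioo 0 x))
    (hrloc : ∀ x ∈ I, IntegrableOn r (Ioo 0 x))
    (hwint : IntegrableOn w I)
    (W R : ℝ → ℝ)
    (hW : ∀ x, W x = ∫ ξ in Ioo (0 : ℝ) x, w ξ)
    (hR : ∀ x, R x = ∫ ξ in Ioo (0 : ℝ) x, r ξ)
    (Wb : ℝ) (hWb : Wb = ∫ ξ in I, w ξ)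
    (hRw : ∫⁻ ξ in I, ENNReal.ofReal (R ξ * w ξ) < ⊤) :
    Tendsto (fun x => R x * (Wb - W x))
      (Filter.comap (fun x : ℝ => ENNReal.ofReal x) (nhdsWithin b (Iio b)) ⊓ 𝓟 I)
      (nhds 0) := by
  have hIm : MeasurableSet I := by
    rw [hI]
    exact measurableSet_Ioi.inter (measurableSet_lt ENNReal.measurable_ofReal measurable_const)
  have hsub : ∀ x ∈ I, Ioo 0 x ⊆ I := by
    intro x hx y hy
    rw [hI] at hx ⊢
    exact ⟨hy.1, (ENNReal.ofReal_le_ofReal hy.2.le).trans_lt hx.2⟩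
  have hrnn : ∀ x ∈ I, 0 ≤ᵐ[volume.restrict (Ioo 0 x)] r := fun x hx =>
    (ae_restrict_of_ae_restrict_of_subset (hsub x hx) hrpos).mono fun _ h => h.le
  have hRnn : ∀ x ∈ I, 0 ≤ R x := fun x hx => by
    rw [hR]
    exact integral_nonneg_of_ae (hrnn x hx)
  have hRmono : MonotoneOn R I := fun x _ y hy hxy => by
    rw [hR, hR]
    exact setIntegral_mono_set (hrloc y hy) (hrnn y hy)
      (Ioo_subset_Ioo_right hxy).eventuallyLE
  have hRwnn : 0 ≤ᵐ[volume.restrict I] fun ξ => R ξ * w ξ := by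
    filter_upwards [hwpos, ae_restrict_mem hIm] with ξ hw hξ
    exact mul_nonneg (hRnn ξ hξ) hw.le
  have hRwm : AEStronglyMeasurable (fun ξ => R ξ * w ξ) (volume.restrict I) :=
    ((aemeasurable_restrict_of_monotoneOn hIm hRmono).mul hwm.aemeasurable).aestronglyMeasurable
  have hRwint : IntegrableOn (fun ξ => R ξ * w ξ) I :=
    ⟨hRwm, (hasFiniteIntegral_iff_ofReal hRwnn).2 hRw⟩
  have htail : Tendsto (fun x => ∫ ξ in I, (Ici x).indicator (fun ξ => R ξ * w ξ) ξ)
      (comap (fun x : ℝ => ENNReal.ofReal x) (nhdsWithin b (Iio b)) ⊓ 𝓟 I) (nhds 0) := by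
    rw [← integral_zero ℝ ℝ (μ := volume.restrict I)]
    refine tendsto_integral_filter_of_dominated_convergence (fun ξ => ‖R ξ * w ξ‖)
      (.of_forall fun x => hRwm.indicator measurableSet_Ici)
      (.of_forall fun x => .of_forall fun ξ => norm_indicator_le_norm_self _ _)
      hRwint.norm ?_
    filter_upwards [ae_restrict_mem hIm] with ξ hξ
    rw [hI] at hξ
    have hlt : ∀ᶠ x in comap (fun x : ℝ => ENNReal.ofReal x) (nhdsWithin b (Iio b)), ξ < x :=
      ((eventually_nhdsWithin_of_eventually_nhds (lt_mem_nhds hξ.2)).comap _).mono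
        fun x hx => lt_of_not_ge fun h => (ENNReal.ofReal_le_ofReal h).not_gt hx
    refine tendsto_const_nhds.congr' ((hlt.filter_mono inf_le_left).mono fun x hx => ?_)
    exact (indicator_of_notMem (notMem_Ici.2 hx) _).symm
  have hWtail : ∀ x ∈ I, Wb - W x = ∫ ξ in I, (Ici x).indicator w ξ := by
    intro x hx
    rw [hW, hWb, ← setIntegral_sdiff measurableSet_Ioo hwint (hsub x hx),
      setIntegral_indicator measurableSet_Ici]
    congr 2
    ext y
    simp only [hI, Set.mem_sdiff, mem_inter_iff, mem_ofPred_eq, mem_Ioo, mem_Ici]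
    grind
  have hmem : ∀ᶠ x in comap (fun x : ℝ => ENNReal.ofReal x) (nhdsWithin b (Iio b)) ⊓ 𝓟 I,
      x ∈ I := mem_inf_of_right (mem_principal_self I)
  refine squeeze_zero' (hmem.mono fun x hx => ?_) (hmem.mono fun x hx => ?_) htail
  · rw [hWtail x hx]
    refine mul_nonneg (hRnn x hx) (integral_nonneg_of_ae ?_)
    filter_upwards [hwpos] with ξ hw
    exact indicator_apply_nonneg (fun _ => hw.le)
  · rw [hWtail x hx, ← integral_const_mul]
    refine integral_mono_ae ((hwint.indicator measurableSet_Ici).const_mul _)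
      (hRwint.indicator measurableSet_Ici) ?_
    filter_upwards [hwpos, ae_restrict_mem hIm] with ξ hw hξ
    by_cases h : ξ ∈ Ici x
    · simpa [h] using mul_le_mul_of_nonneg_right (hRmono hx hξ h) hw.le
    · simp [h]
end

section
/- Let a > 0 and let f : (0,a] → (0,∞) be locally integrable on (0,a]. For γ ∈ ℝ consider the two conditions: (A.5) ∫_0^a s^{γ−1} f(s) ds < ∞; and (A.6) lim_{v↓0} (1/(v^γ f(v))) ∫_0^v s^{γ−1} f(s) ds = 1/(γ+α). Then for α ∈ ℝ the following are equivalent: (a) f is regularly varying at 0₊ with index α; (b) for every γ ∈ ℝ with γ + α > 0, conditions (A.5) and (A.6) hold; (c) there exists γ ∈ ℝ with γ + α > 0 such that conditions (A.5) and (A.6) hold. -/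
open Filter MeasureTheory

/-- A function `f : (0,a] → (0,∞)` is regularly varying at `0₊` with index `α` if
`f(λx)/f(x) → λ^α` as `x ↓ 0`, for every `λ > 0`. -/
def RegularlyVaryingAtZero (f : ℝ → ℝ) (α : ℝ) : Prop :=
  ∀ l : ℝ, 0 < l →
    Tendsto (fun x => f (l * x) / f x) (nhdsWithin 0 (Set.Ioi 0)) (nhds (l ^ α))

open Set Topology

theorem tendsto_const_mul_nhdsGT_zero {l : ℝ} (hl : 0 < l) :
    Tendsto (fun x : ℝ => l * x) (𝓝[>] 0) (𝓝[>] 0) := by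
  refine tendsto_nhdsWithin_iff.2 ⟨?_, ?_⟩
  · have : Tendsto (fun x : ℝ => l * x) (𝓝 0) (𝓝 (l * 0)) := tendsto_id.const_mul l
    rw [mul_zero] at this
    exact this.mono_left nhdsWithin_le_nhds
  · filter_upwards [self_mem_nhdsWithin] with x hx
    exact mul_pos hl hx

/-- It suffices to check regular variation for dilations by `l ≥ 1`. -/
theorem RegularlyVaryingAtZero.of_one_le {f : ℝ → ℝ} {α : ℝ}
    (h : ∀ l : ℝ, 1 ≤ l → Tendsto (fun x => f (l * x) / f x) (𝓝[>] 0) (𝓝 (l ^ α))) :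
    RegularlyVaryingAtZero f α := by
  intro l hl
  rcases le_total 1 l with h1 | h1
  · exact h l h1
  have hinv := ((h l⁻¹ ((one_le_inv₀ hl).2 h1)).comp (tendsto_const_mul_nhdsGT_zero hl)).inv₀
    (Real.rpow_pos_of_pos (inv_pos.2 hl) α).ne'
  rw [Real.inv_rpow hl.le, inv_inv] at hinv
  refine hinv.congr fun x => ?_
  simp only [Function.comp_apply, inv_div, inv_mul_cancel_left₀ hl.ne']

/-- Multiplying by a power shifts the index of regular variation. -/
theorem RegularlyVaryingAtZero.rpow_mul {f : ℝ → ℝ} {α : ℝ} (h : RegularlyVaryingAtZero f α)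
    (p : ℝ) : RegularlyVaryingAtZero (fun s => s ^ p * f s) (p + α) := by
  intro l hl
  have := (h l hl).const_mul (l ^ p)
  rw [← Real.rpow_add hl] at this
  refine this.congr' ?_
  filter_upwards [self_mem_nhdsWithin] with x hx
  have hx : 0 < x := hx
  rw [Real.mul_rpow hl.le hx.le]
  have := (Real.rpow_pos_of_pos hx p).ne'
  field_simp

theorem RegularlyVaryingAtZero.congr_pos {f g : ℝ → ℝ} {α : ℝ} (h : RegularlyVaryingAtZero f α)
    (hfg : ∀ x, 0 < x → f x = g x) : RegularlyVaryingAtZero g α := by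
  intro l hl
  refine (h l hl).congr' ?_
  filter_upwards [self_mem_nhdsWithin] with x hx
  have hx : 0 < x := hx
  rw [hfg x hx, hfg (l * x) (mul_pos hl hx)]

/-- A Grönwall inequality in integral form for the kernel `c / s`. -/
theorem le_mul_rpow_of_sub_le_integral {F : ℝ → ℝ} {x y c : ℝ} (hx : 0 < x) (hxy : x ≤ y)
    (hc : 0 ≤ c) (hF : ContinuousOn F (Icc x y))
    (h : ∀ u ∈ Icc x y, F u - F x ≤ ∫ s in x..u, c * F s / s) :
    F y ≤ F x * (y / x) ^ c := by
  have hy : 0 < y := hx.trans_le hxy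
  have hk : ContinuousOn (fun s => c * F s / s) (Icc x y) :=
    (continuousOn_const.mul hF).div continuousOn_id fun s hs => (hx.trans_le hs.1).ne'
  have hkint : IntervalIntegrable (fun s => c * F s / s) volume x y :=
    ContinuousOn.intervalIntegrable_of_Icc hxy hk
  set H : ℝ → ℝ := fun u => F x + ∫ s in x..u, c * F s / s with hH
  have hHc : ContinuousOn H (Icc x y) := by
    refine continuousOn_const.add ?_
    have := intervalIntegral.continuousOn_primitive_interval' hkint left_mem_uIcc
    rwa [uIcc_of_le hxy] at this
  have hderiv : ∀ u ∈ Ioo x y, HasDerivAt H (c * F u / u) u := by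
    intro u hu
    refine HasDerivAt.const_add _ ?_
    refine intervalIntegral.integral_hasDerivAt_right ?_ ?_ ?_
    · exact ContinuousOn.intervalIntegrable_of_Icc hu.1.le
        (hk.mono (Icc_subset_Icc_right hu.2.le))
    · exact (hk.mono Ioo_subset_Icc_self).stronglyMeasurableAtFilter isOpen_Ioo u hu
    · exact hk.continuousAt (Icc_mem_nhds hu.1 hu.2)
  have hanti : AntitoneOn (fun u => H u * u ^ (-c)) (Icc x y) := by
    refine antitoneOn_of_hasDerivWithinAt_nonpos (convex_Icc x y) ?_
      (f' := fun u => c * F u / u * u ^ (-c) + H u * (-c * u ^ (-c - 1))) ?_ ?_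
    · exact hHc.mul (continuousOn_id.rpow_const fun s hs => Or.inl (hx.trans_le hs.1).ne')
    · intro u hu
      rw [interior_Icc] at hu
      exact ((hderiv u hu).mul
        (Real.hasDerivAt_rpow_const (Or.inl (hx.trans hu.1).ne'))).hasDerivWithinAt
    · intro u hu
      rw [interior_Icc] at hu
      have hu0 : 0 < u := hx.trans hu.1
      have h1 := h u (Ioo_subset_Icc_self hu)
      have h2 : c * F u / u * u ^ (-c) + H u * (-c * u ^ (-c - 1))
          = c * u ^ (-c - 1) * (F u - H u) := by
        rw [Real.rpow_sub_one hu0.ne']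
        field_simp
        ring
      rw [h2]
      refine mul_nonpos_of_nonneg_of_nonpos (by positivity) ?_
      simp only [hH]
      linarith
  have h1 := hanti (left_mem_Icc.2 hxy) (right_mem_Icc.2 hxy) hxy
  simp only [hH, intervalIntegral.integral_same, add_zero] at h1
  have h2 := h y (right_mem_Icc.2 hxy)
  rw [Real.rpow_neg hx.le, Real.rpow_neg hy.le, ← div_eq_mul_inv, ← div_eq_mul_inv,
    div_le_iff₀ (Real.rpow_pos_of_pos hy c)] at h1
  rw [Real.div_rpow hy.le hx.le]
  calc F y ≤ _ := by linarith
    _ ≤ _ := h1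
    _ = _ := by ring

section Karamata

variable {g : ℝ → ℝ} {a β : ℝ}

theorem intervalIntegrable_of_integrableOn_Ioc (hg : IntegrableOn g (Ioc 0 a)) {x y : ℝ}
    (hx : 0 ≤ x) (hxy : x ≤ y) (hy : y ≤ a) : IntervalIntegrable g volume x y :=
  (intervalIntegrable_iff_integrableOn_Ioc_of_le hxy).2
    (hg.mono_set (Ioc_subset_Ioc hx hy))

theorem intervalIntegral_pos_of_integrableOn_Ioc (hpos : ∀ x ∈ Ioc 0 a, 0 < g x)
    (hg : IntegrableOn g (Ioc 0 a)) {v : ℝ} (hv : v ∈ Ioc 0 a) : 0 < ∫ s in 0..v, g s :=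
  intervalIntegral.intervalIntegral_pos_of_pos_on
    (intervalIntegrable_of_integrableOn_Ioc hg le_rfl hv.1.le hv.2)
    (fun s hs => hpos s ⟨hs.1, hs.2.le.trans hv.2⟩) hv.1

theorem integral_sub_integral_eq (hg : IntegrableOn g (Ioc 0 a)) {x y : ℝ}
    (hx : 0 ≤ x) (hxy : x ≤ y) (hy : y ≤ a) :
    (∫ s in 0..y, g s) - ∫ s in 0..x, g s = ∫ s in x..y, g s :=
  intervalIntegral.integral_interval_sub_left
    (intervalIntegrable_of_integrableOn_Ioc hg le_rfl (hx.trans hxy) hy)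
    (intervalIntegrable_of_integrableOn_Ioc hg le_rfl hx (hxy.trans hy))

/-- If `v g(v) / ∫₀ᵛ g → β`, then the primitive `∫₀ᵛ g` is regularly varying with index `β`. -/
theorem tendsto_primitive_ratio (ha : 0 < a) (hβ : 0 < β) (hpos : ∀ x ∈ Ioc 0 a, 0 < g x)
    (hg : IntegrableOn g (Ioc 0 a))
    (h : Tendsto (fun v => v * g v / ∫ s in 0..v, g s) (𝓝[>] 0) (𝓝 β)) {l : ℝ} (hl : 1 ≤ l) :
    Tendsto (fun v => (∫ s in 0..l * v, g s) / ∫ s in 0..v, g s) (𝓝[>] 0) (𝓝 (l ^ β)) := by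
  have hl0 : 0 < l := one_pos.trans_le hl
  set F : ℝ → ℝ := fun v => ∫ s in 0..v, g s with hF
  have hFpos : ∀ v ∈ Ioc 0 a, 0 < F v := fun v hv =>
    intervalIntegral_pos_of_integrableOn_Ioc hpos hg hv
  have hFc : ContinuousOn F (Icc 0 a) := by
    have := intervalIntegral.continuousOn_primitive_interval'
      (intervalIntegrable_of_integrableOn_Ioc hg le_rfl ha.le le_rfl) left_mem_uIcc
    rwa [uIcc_of_le ha.le] at this
  have hkint : ∀ c x y : ℝ, 0 < x → x ≤ y → y ≤ a →
      IntervalIntegrable (fun s => c * F s / s) volume x y := fun c x y hx hxy hy =>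
    ContinuousOn.intervalIntegrable_of_Icc hxy
      ((continuousOn_const.mul (hFc.mono (Icc_subset_Icc hx.le hy))).div continuousOn_id
        fun s hs => (hx.trans_le hs.1).ne')
  have hcont : Tendsto (fun c => l ^ c) (𝓝 β) (𝓝 (l ^ β)) :=
    (Real.continuous_const_rpow hl0.ne').tendsto β
  rw [tendsto_order]
  constructor
  · intro r hr
    obtain ⟨c, ⟨hrc, hc0⟩, hcβ⟩ := (((hcont.eventually_const_lt hr).and
      (lt_mem_nhds hβ)).filter_mono (nhdsWithin_le_nhds (s := Iio β))).and
      self_mem_nhdsWithin |>.exists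
    obtain ⟨δ, hδ, hδc⟩ := mem_nhdsGT_iff_exists_Ioo_subset.1 (h.eventually_const_lt hcβ)
    have hδ : 0 < δ := hδ
    filter_upwards [(tendsto_const_mul_nhdsGT_zero hl0) (Ioo_mem_nhdsGT (lt_min hδ ha)),
      self_mem_nhdsWithin] with x hlx hx
    have hx : 0 < x := hx
    have hxlx : x ≤ l * x := le_mul_of_one_le_left hx.le hl
    have hlx2 : l * x < min δ a := hlx.2
    have hlxδ := hlx2.trans_le (min_le_left _ _)
    have hlxa := (hlx2.trans_le (min_le_right _ _)).le
    have := le_mul_rpow_of_sub_le_integral (F := fun v => -F v) hx hxlx hc0.le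
      (hFc.mono (Icc_subset_Icc hx.le hlxa)).neg fun u hu => by
        have hua := hu.2.trans hlxa
        have hm : ∫ s in x..u, c * F s / s ≤ ∫ s in x..u, g s := by
          refine intervalIntegral.integral_mono_on hu.1 (hkint c x u hx hu.1 hua)
            (intervalIntegrable_of_integrableOn_Ioc hg hx.le hu.1 hua) fun s hs => ?_
          have hs0 := hx.trans_le hs.1
          have hsF := hFpos s ⟨hs0, hs.2.trans hua⟩
          have h1 : c < s * g s / F s := hδc ⟨hs0, (hs.2.trans hu.2).trans_lt hlxδ⟩
          rw [lt_div_iff₀ hsF] at h1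
          rw [div_le_iff₀ hs0]
          linarith
        rw [← integral_sub_integral_eq hg hx.le hu.1 hua] at hm
        have hn : ∫ s in x..u, c * -F s / s = -∫ s in x..u, c * F s / s := by
          rw [← intervalIntegral.integral_neg]
          congr 1
          ext s
          ring
        rw [hn]
        simp only [hF] at hm ⊢
        linarith
    rw [mul_div_cancel_right₀ _ hx.ne'] at this
    refine hrc.trans_le ?_
    rw [le_div_iff₀ (hFpos x ⟨hx, hxlx.trans hlxa⟩)]
    linarith
  · intro r hr
    obtain ⟨c, hrc, hcβ⟩ := ((hcont.eventually_lt_const hr).filter_mono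
      (nhdsWithin_le_nhds (s := Ioi β))).and self_mem_nhdsWithin |>.exists
    have hcβ : β < c := hcβ
    obtain ⟨δ, hδ, hδc⟩ := mem_nhdsGT_iff_exists_Ioo_subset.1 (h.eventually_lt_const hcβ)
    have hδ : 0 < δ := hδ
    filter_upwards [(tendsto_const_mul_nhdsGT_zero hl0) (Ioo_mem_nhdsGT (lt_min hδ ha)),
      self_mem_nhdsWithin] with x hlx hx
    have hx : 0 < x := hx
    have hxlx : x ≤ l * x := le_mul_of_one_le_left hx.le hl
    have hlx2 : l * x < min δ a := hlx.2
    have hlxδ := hlx2.trans_le (min_le_left _ _)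
    have hlxa := (hlx2.trans_le (min_le_right _ _)).le
    have := le_mul_rpow_of_sub_le_integral (F := F) hx hxlx (hβ.trans hcβ).le
      (hFc.mono (Icc_subset_Icc hx.le hlxa)) fun u hu => by
        have hua := hu.2.trans hlxa
        simp only [hF]
        rw [integral_sub_integral_eq hg hx.le hu.1 hua]
        refine intervalIntegral.integral_mono_on hu.1
          (intervalIntegrable_of_integrableOn_Ioc hg hx.le hu.1 hua)
          (hkint c x u hx hu.1 hua) fun s hs => ?_
        have hs0 := hx.trans_le hs.1
        have hsF := hFpos s ⟨hs0, hs.2.trans hua⟩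
        have h1 : s * g s / F s < c := hδc ⟨hs0, (hs.2.trans hu.2).trans_lt hlxδ⟩
        rw [div_lt_iff₀ hsF] at h1
        rw [le_div_iff₀ hs0]
        simp only [hF] at h1
        linarith
    rw [mul_div_cancel_right₀ _ hx.ne'] at this
    refine lt_of_le_of_lt ?_ hrc
    rw [div_le_iff₀ (hFpos x ⟨hx, hxlx.trans hlxa⟩)]
    linarith

/-- Converse half of Karamata's theorem. -/
theorem regularlyVaryingAtZero_of_tendsto (ha : 0 < a) (hβ : 0 < β)
    (hpos : ∀ x ∈ Ioc 0 a, 0 < g x) (hg : IntegrableOn g (Ioc 0 a))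
    (h : Tendsto (fun v => v * g v / ∫ s in 0..v, g s) (𝓝[>] 0) (𝓝 β)) :
    RegularlyVaryingAtZero g (β - 1) := by
  refine RegularlyVaryingAtZero.of_one_le fun l hl => ?_
  have hl0 : 0 < l := one_pos.trans_le hl
  have hlim := ((((h.comp (tendsto_const_mul_nhdsGT_zero hl0)).div h hβ.ne').mul
    (tendsto_primitive_ratio ha hβ hpos hg h hl))).div_const l
  rw [div_self hβ.ne', one_mul, ← Real.rpow_sub_one hl0.ne'] at hlim
  refine hlim.congr' ?_
  filter_upwards [(tendsto_const_mul_nhdsGT_zero hl0) (Ioc_mem_nhdsGT ha),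
    self_mem_nhdsWithin] with x hlx hx
  have hx : 0 < x := hx
  have hxa : x ∈ Ioc 0 a := ⟨hx, (le_mul_of_one_le_left hx.le hl).trans hlx.2⟩
  have h1 := intervalIntegral_pos_of_integrableOn_Ioc hpos hg hxa
  have h2 := intervalIntegral_pos_of_integrableOn_Ioc hpos hg hlx
  have h3 := hpos x hxa
  simp only [Function.comp_apply, Pi.div_apply]
  field_simp

theorem intervalIntegrable_of_integrableOn_Icc
    (hloc : ∀ x, 0 < x → x ≤ a → IntegrableOn g (Icc x a)) {x y : ℝ}
    (hx : 0 < x) (hxy : x ≤ y) (hy : y ≤ a) : IntervalIntegrable g volume x y :=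
  (intervalIntegrable_iff_integrableOn_Ioc_of_le hxy).2
    ((hloc x hx (hxy.trans hy)).mono_set (Ioc_subset_Icc_self.trans (Icc_subset_Icc_right hy)))

/-- A function regularly varying with index `β - 1 > -1` is integrable at `0`. -/
theorem RegularlyVaryingAtZero.integrableOn_Ioc (ha : 0 < a) (hβ : 0 < β)
    (hpos : ∀ x ∈ Ioc 0 a, 0 < g x) (hloc : ∀ x, 0 < x → x ≤ a → IntegrableOn g (Icc x a))
    (h : RegularlyVaryingAtZero g (β - 1)) : IntegrableOn g (Ioc 0 a) := by
  have hlt : (1 / 2 : ℝ) ^ (β - 1) < 2 := by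
    rw [Real.rpow_sub_one (by norm_num)]
    have := Real.rpow_lt_one (x := 1 / 2) (by norm_num) (by norm_num) hβ
    linarith
  obtain ⟨Q, hQ, hQ2⟩ := exists_between hlt
  have hQ0 : 0 < Q := (Real.rpow_pos_of_pos (by norm_num) _).trans hQ
  obtain ⟨δ, hδ, hδQ⟩ := mem_nhdsGT_iff_exists_Ioo_subset.1
    ((h (1 / 2) (by norm_num)).eventually_lt_const hQ)
  have hδ : 0 < δ := hδ
  obtain ⟨v, hv0, hv⟩ := exists_between (lt_min hδ ha)
  have hvδ := hv.trans_le (min_le_left _ _)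
  have hva := (hv.trans_le (min_le_right _ _)).le
  have hii : ∀ {x y : ℝ}, 0 < x → x ≤ y → y ≤ a → IntervalIntegrable g volume x y :=
    fun hx hxy hy => intervalIntegrable_of_integrableOn_Icc hloc hx hxy hy
  have hbound : ∀ x ∈ Ioc 0 v,
      ∫ s in x..v, g s ≤ (∫ s in v / 2..v, g s) / (1 - Q / 2) := by
    intro x hx
    have hx0 := hx.1
    have hhalf : ∫ s in x / 2..v / 2, g s ≤ Q / 2 * ∫ s in x..v, g s := by
      have hsub : ∫ s in x..v, g (1 / 2 * s) = 2 * ∫ s in x / 2..v / 2, g s := by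
        rw [intervalIntegral.integral_comp_mul_left _ (by norm_num)]
        norm_num [div_eq_inv_mul]
      have hmono : ∫ s in x..v, g (1 / 2 * s) ≤ ∫ s in x..v, Q * g s := by
        refine intervalIntegral.integral_mono_on hx.2 ?_ ((hii hx0 hx.2 hva).const_mul Q) ?_
        · have := (hii (x := x / 2) (y := v / 2) (by linarith) (by linarith [hx.2])
            (by linarith)).comp_mul_left (c := 1 / 2)
          simpa only [div_div_eq_mul_div, div_one, div_mul_cancel₀ _ (two_ne_zero' ℝ)] using this
        · intro s hs
          have hs0 := hx0.trans_le hs.1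
          have h1 : g (1 / 2 * s) / g s < Q := hδQ ⟨hs0, hs.2.trans_lt hvδ⟩
          exact ((div_lt_iff₀ (hpos s ⟨hs0, hs.2.trans hva⟩)).1 h1).le
      rw [intervalIntegral.integral_const_mul] at hmono
      linarith
    have hadd := intervalIntegral.integral_add_adjacent_intervals
      (hii (x := x / 2) (y := v / 2) (by linarith) (by linarith [hx.2]) (by linarith))
      (hii (x := v / 2) (y := v) (by linarith) (by linarith) hva)
    have hadd' := intervalIntegral.integral_add_adjacent_intervals
      (hii (x := x / 2) (y := x) (by linarith) (by linarith) (by linarith [hx.2]))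
      (hii (x := x) (y := v) hx0 hx.2 hva)
    have hnn : 0 ≤ ∫ s in x / 2..x, g s :=
      intervalIntegral.integral_nonneg (by linarith) fun s hs =>
        (hpos s ⟨by linarith [hs.1], by linarith [hs.2, hx.2]⟩).le
    rw [le_div_iff₀ (by linarith)]
    linarith
  have hmem : ∀ n : ℕ, v / (n + 1) ∈ Ioc 0 v := fun n =>
    ⟨by positivity, div_le_self hv0.le (le_add_of_nonneg_left n.cast_nonneg)⟩
  have hleft : IntegrableOn g (Ioc 0 v) := by
    refine integrableOn_Ioc_of_intervalIntegral_norm_bounded_left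
      (l := atTop) (a := fun n : ℕ => v / (n + 1))
      (I := (∫ s in v / 2..v, g s) / (1 - Q / 2)) (fun n => ?_) ?_
      (Eventually.of_forall fun n => ?_)
    · exact (hii (hmem n).1 (hmem n).2 hva).1
    · exact tendsto_const_nhds.div_atTop
        (tendsto_atTop_add_const_right _ _ tendsto_natCast_atTop_atTop)
    · have hx := hmem n
      rw [← intervalIntegral.integral_of_le hx.2]
      refine le_trans (le_of_eq ?_) (hbound _ hx)
      refine intervalIntegral.integral_congr fun s hs => ?_
      rw [uIcc_of_le hx.2] at hs
      exact Real.norm_of_nonneg (hpos s ⟨hx.1.trans_le hs.1, hs.2.trans hva⟩).le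
  rw [← Ioc_union_Ioc_eq_Ioc hv0.le hva]
  exact hleft.union ((hloc v hv0 hva).mono_set Ioc_subset_Icc_self)

/-- The primitive of a function regularly varying with index `β - 1 > -1` satisfies
`F(v/2) / F(v) → 2 ^ (-β)`. -/
theorem RegularlyVaryingAtZero.tendsto_primitive_half (ha : 0 < a)
    (hpos : ∀ x ∈ Ioc 0 a, 0 < g x) (hg : IntegrableOn g (Ioc 0 a))
    (h : RegularlyVaryingAtZero g (β - 1)) :
    Tendsto (fun v => (∫ s in 0..v / 2, g s) / ∫ s in 0..v, g s) (𝓝[>] 0)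
      (𝓝 ((1 / 2) ^ β)) := by
  have hp : (1 / 2 : ℝ) ^ β = (1 / 2) ^ (β - 1) / 2 := by
    rw [Real.rpow_sub_one (by norm_num)]
    ring
  have hsub : ∀ v, ∫ s in 0..v, g (1 / 2 * s) = 2 * ∫ s in 0..v / 2, g s := by
    intro v
    rw [intervalIntegral.integral_comp_mul_left _ (by norm_num)]
    norm_num [div_eq_inv_mul]
  have hint : ∀ v ∈ Ioc 0 a, IntervalIntegrable (fun s => g (1 / 2 * s)) volume 0 v := by
    intro v hv
    have := (intervalIntegrable_of_integrableOn_Ioc hg (x := 0) (y := v / 2) le_rfl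
      (by linarith [hv.1]) (by linarith [hv.1, hv.2])).comp_mul_left (c := 1 / 2)
    simpa only [div_div_eq_mul_div, div_one, zero_div, zero_mul,
      div_mul_cancel₀ _ (two_ne_zero' ℝ)] using this
  rw [tendsto_order]
  constructor
  · intro r hr
    have hr2 : 2 * r < (1 / 2) ^ (β - 1) := by linarith
    obtain ⟨δ, hδ, hδr⟩ := mem_nhdsGT_iff_exists_Ioo_subset.1
      ((h (1 / 2) (by norm_num)).eventually_const_lt hr2)
    have hδ : 0 < δ := hδ
    filter_upwards [Ioo_mem_nhdsGT (lt_min hδ ha)] with v hv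
    have hvδ := hv.2.trans_le (min_le_left _ _)
    have hva : v ∈ Ioc 0 a := ⟨hv.1, (hv.2.trans_le (min_le_right _ _)).le⟩
    have hgi := intervalIntegrable_of_integrableOn_Ioc hg le_rfl hva.1.le hva.2
    rw [lt_div_iff₀ (intervalIntegral_pos_of_integrableOn_Ioc hpos hg hva)]
    have hmono : 0 < ∫ s in 0..v, (g (1 / 2 * s) - 2 * r * g s) := by
      refine intervalIntegral.intervalIntegral_pos_of_pos_on
        ((hint v hva).sub (hgi.const_mul _)) (fun s hs => ?_) hv.1
      have h1 : 2 * r < g (1 / 2 * s) / g s := hδr ⟨hs.1, hs.2.trans hvδ⟩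
      rw [lt_div_iff₀ (hpos s ⟨hs.1, hs.2.le.trans hva.2⟩)] at h1
      linarith
    rw [intervalIntegral.integral_sub (hint v hva) (hgi.const_mul _),
      intervalIntegral.integral_const_mul, hsub] at hmono
    linarith
  · intro r hr
    have hr2 : (1 / 2) ^ (β - 1) < 2 * r := by linarith
    obtain ⟨δ, hδ, hδr⟩ := mem_nhdsGT_iff_exists_Ioo_subset.1
      ((h (1 / 2) (by norm_num)).eventually_lt_const hr2)
    have hδ : 0 < δ := hδ
    filter_upwards [Ioo_mem_nhdsGT (lt_min hδ ha)] with v hv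
    have hvδ := hv.2.trans_le (min_le_left _ _)
    have hva : v ∈ Ioc 0 a := ⟨hv.1, (hv.2.trans_le (min_le_right _ _)).le⟩
    have hgi := intervalIntegrable_of_integrableOn_Ioc hg le_rfl hva.1.le hva.2
    rw [div_lt_iff₀ (intervalIntegral_pos_of_integrableOn_Ioc hpos hg hva)]
    have hmono : 0 < ∫ s in 0..v, (2 * r * g s - g (1 / 2 * s)) := by
      refine intervalIntegral.intervalIntegral_pos_of_pos_on
        ((hgi.const_mul _).sub (hint v hva)) (fun s hs => ?_) hv.1
      have h1 : g (1 / 2 * s) / g s < 2 * r := hδr ⟨hs.1, hs.2.trans hvδ⟩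
      rw [div_lt_iff₀ (hpos s ⟨hs.1, hs.2.le.trans hva.2⟩)] at h1
      linarith
    rw [intervalIntegral.integral_sub (hgi.const_mul _) (hint v hva),
      intervalIntegral.integral_const_mul, hsub] at hmono
    linarith

theorem integral_comp_mul_half_one (g : ℝ → ℝ) {v : ℝ} (hv : v ≠ 0) :
    v * ∫ t in (1 / 2 : ℝ)..1, g (v * t) = ∫ s in v / 2..v, g s := by
  rw [intervalIntegral.integral_comp_mul_left _ hv, smul_eq_mul, mul_inv_cancel_left₀ hv,
    mul_one, mul_one_div]

theorem intervalIntegrable_comp_mul_half_one (hg : IntegrableOn g (Ioc 0 a)) {v : ℝ}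
    (hv : v ∈ Ioc 0 a) : IntervalIntegrable (fun t => g (v * t)) volume (1 / 2) 1 := by
  have := (intervalIntegrable_of_integrableOn_Ioc hg (x := v / 2) (y := v) (by linarith [hv.1])
    (by linarith [hv.1]) hv.2).comp_mul_left (c := v)
  rwa [div_right_comm, div_self hv.1.ne'] at this

theorem continuousOn_rpow_half_one (p : ℝ) :
    ContinuousOn (fun t : ℝ => t ^ p) (Icc (1 / 2) 1) :=
  continuousOn_id.rpow_const fun t ht => Or.inl (lt_of_lt_of_le (by norm_num) ht.1).ne'

theorem eventually_bounded_half_one (ha : 0 < a) (hgm : Measurable g)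
    (hpos : ∀ x ∈ Ioc 0 a, 0 < g x) (hg : IntegrableOn g (Ioc 0 a))
    (h : RegularlyVaryingAtZero g (β - 1)) :
    ∃ M : ℝ, 0 < M ∧ ∀ᶠ v in 𝓝[>] 0, v * g v ≤ M * ∫ s in 0..v, g s := by
  set c : ℝ := ∫ t in (1 / 2 : ℝ)..1, min (t ^ (β - 1)) 1 with hc
  have hcpos : 0 < c := by
    refine intervalIntegral.intervalIntegral_pos_of_pos_on ?_ (fun t ht => ?_) (by norm_num)
    · exact ContinuousOn.intervalIntegrable_of_Icc (by norm_num)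
        (ContinuousOn.inf (continuousOn_rpow_half_one _) continuousOn_const)
    · have : (0 : ℝ) < t := lt_trans (by norm_num) ht.1
      positivity
  have hlim : Tendsto (fun v => ∫ t in (1 / 2 : ℝ)..1, min (g (v * t) / g v) 1) (𝓝[>] 0)
      (𝓝 c) := by
    refine intervalIntegral.tendsto_integral_filter_of_dominated_convergence (fun _ => 1)
      ?_ ?_ (by simp) ?_
    · refine Eventually.of_forall fun v => Measurable.aestronglyMeasurable ?_
      exact ((hgm.comp (measurable_const_mul v)).div_const _).min measurable_const
    · filter_upwards [Ioc_mem_nhdsGT ha] with v hv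
      refine Eventually.of_forall fun t ht => ?_
      rw [uIoc_of_le (by norm_num)] at ht
      have ht0 : (0 : ℝ) < t := lt_trans (by norm_num) ht.1
      have h1 := hpos (v * t) ⟨mul_pos hv.1 ht0, (mul_le_of_le_one_right hv.1.le ht.2).trans hv.2⟩
      have h2 := hpos v hv
      rw [Real.norm_of_nonneg (by positivity)]
      exact min_le_right _ _
    · refine Eventually.of_forall fun t ht => ?_
      rw [uIoc_of_le (by norm_num)] at ht
      have ht0 : (0 : ℝ) < t := lt_trans (by norm_num) ht.1
      simpa only [mul_comm t] using (h t ht0).min tendsto_const_nhds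
  refine ⟨2 / c, by positivity, ?_⟩
  filter_upwards [hlim.eventually_const_lt (half_lt_self hcpos), Ioc_mem_nhdsGT ha] with v hcv hv
  have hgv := hpos v hv
  have hgi := intervalIntegrable_comp_mul_half_one hg hv
  have hle : ∫ t in (1 / 2 : ℝ)..1, min (g (v * t) / g v) 1
      ≤ ∫ t in (1 / 2 : ℝ)..1, g (v * t) / g v := by
    refine intervalIntegral.integral_mono_on (by norm_num) ?_ (hgi.div_const _)
      fun t _ => min_le_left _ _
    exact intervalIntegrable_iff.2 ((intervalIntegrable_iff.1 (hgi.div_const _)).inf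
      (intervalIntegrable_iff.1 intervalIntegrable_const))
  rw [intervalIntegral.integral_div] at hle
  have hsub := integral_sub_integral_eq hg (x := v / 2) (y := v) (by linarith [hv.1])
    (by linarith [hv.1]) hv.2
  have hF2 := intervalIntegral_pos_of_integrableOn_Ioc hpos hg (v := v / 2)
    ⟨by linarith [hv.1], by linarith [hv.1, hv.2]⟩
  rw [← integral_comp_mul_half_one g hv.1.ne'] at hsub
  have h3 := hcv.trans_le hle
  rw [lt_div_iff₀ hgv] at h3
  have h4 := mul_lt_mul_of_pos_left h3 hv.1
  rw [div_mul_eq_mul_div, le_div_iff₀ hcpos]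
  linarith

/-- Direct half of Karamata's theorem. -/
theorem RegularlyVaryingAtZero.tendsto_primitive (ha : 0 < a) (hβ : 0 < β) (hgm : Measurable g)
    (hpos : ∀ x ∈ Ioc 0 a, 0 < g x) (hg : IntegrableOn g (Ioc 0 a))
    (h : RegularlyVaryingAtZero g (β - 1)) :
    Tendsto (fun v => v * g v / ∫ s in 0..v, g s) (𝓝[>] 0) (𝓝 β) := by
  obtain ⟨M, hM, hMev⟩ := eventually_bounded_half_one ha hgm hpos hg h
  set F : ℝ → ℝ := fun v => ∫ s in 0..v, g s with hF
  have hFpos : ∀ v ∈ Ioc 0 a, 0 < F v := fun v hv =>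
    intervalIntegral_pos_of_integrableOn_Ioc hpos hg hv
  have hFmono : ∀ x y, 0 ≤ x → x ≤ y → y ≤ a → F x ≤ F y := by
    intro x y hx hxy hy
    rw [← sub_nonneg]
    simp only [hF]
    rw [integral_sub_integral_eq hg hx hxy hy, intervalIntegral.integral_of_le hxy]
    exact setIntegral_nonneg measurableSet_Ioc fun s hs =>
      (hpos s ⟨hx.trans_lt hs.1, hs.2.trans hy⟩).le
  obtain ⟨δ, hδ, hδM⟩ := mem_nhdsGT_iff_exists_Ioo_subset.1 hMev
  have hδ : 0 < δ := hδ
  have hδM : ∀ v ∈ Ioo 0 δ, v * g v ≤ M * F v := fun v hv => hδM hv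
  have hlim : Tendsto (fun v => ∫ t in (1 / 2 : ℝ)..1,
      v / F v * (g (v * t) - t ^ (β - 1) * g v)) (𝓝[>] 0) (𝓝 (∫ t in (1 / 2 : ℝ)..1, 0)) := by
    refine intervalIntegral.tendsto_integral_filter_of_dominated_convergence
      (fun t => 2 * M + t ^ (β - 1) * M) ?_ ?_ ?_ ?_
    · refine Eventually.of_forall fun v => Measurable.aestronglyMeasurable ?_
      exact ((hgm.comp (measurable_const_mul v)).sub
        ((measurable_id.pow_const _).mul_const _)).const_mul _
    · filter_upwards [Ioo_mem_nhdsGT (lt_min hδ ha)] with v hv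
      refine Eventually.of_forall fun t ht => ?_
      rw [uIoc_of_le (by norm_num)] at ht
      have ht0 : (0 : ℝ) < t := lt_trans (by norm_num) ht.1
      have hvδ := hv.2.trans_le (min_le_left _ _)
      have hva := (hv.2.trans_le (min_le_right _ _)).le
      have hvt0 := mul_pos hv.1 ht0
      have hvt : v * t ≤ v := mul_le_of_le_one_right hv.1.le ht.2
      have hFv := hFpos v ⟨hv.1, hva⟩
      have hgv := hpos v ⟨hv.1, hva⟩
      have hgvt := hpos (v * t) ⟨hvt0, hvt.trans hva⟩
      have h1 := hδM v ⟨hv.1, hvδ⟩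
      have h2 := hδM (v * t) ⟨hvt0, hvt.trans_lt hvδ⟩
      have h3 := mul_le_mul_of_nonneg_left (hFmono _ _ hvt0.le hvt hva) hM.le
      have hp : 0 < t ^ (β - 1) := Real.rpow_pos_of_pos ht0 _
      have h4 : v / F v * g v ≤ M := by
        rw [div_mul_eq_mul_div, div_le_iff₀ hFv]
        exact h1
      have h5 : v / F v * g (v * t) ≤ 2 * M := by
        rw [div_mul_eq_mul_div, div_le_iff₀ hFv]
        have : 1 / 2 * (v * g (v * t)) ≤ t * (v * g (v * t)) :=
          mul_le_mul_of_nonneg_right ht.1.le (mul_pos hv.1 hgvt).le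
        nlinarith
      have hq : 0 < v / F v := div_pos hv.1 hFv
      calc ‖v / F v * (g (v * t) - t ^ (β - 1) * g v)‖
          = ‖v / F v * g (v * t) - t ^ (β - 1) * (v / F v * g v)‖ := by ring_nf
        _ ≤ ‖v / F v * g (v * t)‖ + ‖t ^ (β - 1) * (v / F v * g v)‖ := norm_sub_le _ _
        _ = v / F v * g (v * t) + t ^ (β - 1) * (v / F v * g v) := by
          rw [Real.norm_of_nonneg (by positivity), Real.norm_of_nonneg (by positivity)]
        _ ≤ _ := add_le_add h5 (mul_le_mul_of_nonneg_left h4 hp.le)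
    · exact ContinuousOn.intervalIntegrable_of_Icc (by norm_num)
        (continuousOn_const.add ((continuousOn_rpow_half_one _).mul continuousOn_const))
    · refine Eventually.of_forall fun t ht => ?_
      rw [uIoc_of_le (by norm_num)] at ht
      have ht0 : (0 : ℝ) < t := lt_trans (by norm_num) ht.1
      have hsub := (h t ht0).sub_const (t ^ (β - 1))
      rw [sub_self] at hsub
      refine squeeze_zero_norm' ?_ (by simpa using hsub.norm.const_mul M)
      filter_upwards [Ioo_mem_nhdsGT (lt_min hδ ha)] with v hv
      have hvδ := hv.2.trans_le (min_le_left _ _)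
      have hva := (hv.2.trans_le (min_le_right _ _)).le
      have hFv := hFpos v ⟨hv.1, hva⟩
      have hgv := hpos v ⟨hv.1, hva⟩
      have h1 : v * g v / F v ≤ M := (div_le_iff₀ hFv).2 (hδM v ⟨hv.1, hvδ⟩)
      have h2 : 0 ≤ v * g v / F v := div_nonneg (mul_pos hv.1 hgv).le hFv.le
      have heq : v / F v * (g (v * t) - t ^ (β - 1) * g v)
          = v * g v / F v * (g (t * v) / g v - t ^ (β - 1)) := by
        rw [mul_comm t v]
        field_simp
      rw [heq, norm_mul, Real.norm_of_nonneg h2]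
      exact mul_le_mul_of_nonneg_right h1 (norm_nonneg _)
  rw [intervalIntegral.integral_zero] at hlim
  have hhalf := h.tendsto_primitive_half ha hpos hg
  have hK : ∫ t in (1 / 2 : ℝ)..1, t ^ (β - 1) = (1 - (1 / 2) ^ β) / β := by
    rw [integral_rpow (Or.inl (by linarith))]
    simp
  have hlt : (1 / 2 : ℝ) ^ β < 1 := Real.rpow_lt_one (by norm_num) (by norm_num) hβ
  have hne : (1 - (1 / 2 : ℝ) ^ β) ≠ 0 := by linarith
  have hfin := ((hhalf.const_sub 1).sub hlim).mul_const (β / (1 - (1 / 2) ^ β))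
  rw [sub_zero, mul_div_cancel₀ _ hne] at hfin
  refine hfin.congr' ?_
  filter_upwards [Ioc_mem_nhdsGT ha] with v hv
  have hFv := hFpos v hv
  rw [intervalIntegral.integral_const_mul, intervalIntegral.integral_sub
    (intervalIntegrable_comp_mul_half_one hg hv)
    ((ContinuousOn.intervalIntegrable_of_Icc (by norm_num)
      (continuousOn_rpow_half_one _)).mul_const _), intervalIntegral.integral_mul_const, hK]
  have hsub := integral_sub_integral_eq hg (x := v / 2) (y := v) (by linarith [hv.1])
    (by linarith [hv.1]) hv.2
  rw [← integral_comp_mul_half_one g hv.1.ne'] at hsub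
  have hF2 : ∫ s in 0..v / 2, g s = F v - v * ∫ t in (1 / 2 : ℝ)..1, g (v * t) := by
    simp only [hF]
    linarith
  rw [hF2]
  change (1 - (F v - v * _) / F v - _) * _ = v * g v / F v
  field_simp
  ring

end Karamata

/-- **Theorem A.6** (Karamata's characterization of regular variation at `0₊`).
For `f : (0,a] → (0,∞)` locally integrable, the following are equivalent:
(a) `f` is regularly varying at `0₊` with index `α`;
(b) for every `γ` with `γ + α > 0`, conditions (A.5) `∫₀ᵃ s^{γ-1} f(s) ds < ∞` and
(A.6) `lim_{v↓0} (v^γ f(v))⁻¹ ∫₀ᵛ s^{γ-1} f(s) ds = 1/(γ+α)` hold;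
(c) these two conditions hold for some `γ` with `γ + α > 0`. -/
theorem stmt_10 (a α : ℝ) (ha : 0 < a) (f : ℝ → ℝ) (hfm : Measurable f)
    (hfpos : ∀ x ∈ Set.Ioc (0 : ℝ) a, 0 < f x)
    (hloc : ∀ x, 0 < x → x ≤ a → IntegrableOn f (Set.Icc x a)) :
    (RegularlyVaryingAtZero f α ↔
      ∀ γ : ℝ, 0 < γ + α →
        (∫⁻ s in Set.Ioc (0 : ℝ) a, ENNReal.ofReal (s ^ (γ - 1) * f s)) < ⊤ ∧
        Tendsto (fun v => (1 / (v ^ γ * f v)) * ∫ s in Set.Ioc (0 : ℝ) v, s ^ (γ - 1) * f s)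
          (nhdsWithin 0 (Set.Ioi 0)) (nhds (1 / (γ + α)))) ∧
    (RegularlyVaryingAtZero f α ↔
      ∃ γ : ℝ, 0 < γ + α ∧
        (∫⁻ s in Set.Ioc (0 : ℝ) a, ENNReal.ofReal (s ^ (γ - 1) * f s)) < ⊤ ∧
        Tendsto (fun v => (1 / (v ^ γ * f v)) * ∫ s in Set.Ioc (0 : ℝ) v, s ^ (γ - 1) * f s)
          (nhdsWithin 0 (Set.Ioi 0)) (nhds (1 / (γ + α)))) := by
  have hgm : ∀ γ : ℝ, Measurable fun s => s ^ (γ - 1) * f s := fun γ =>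
    (measurable_id.pow_const _).mul hfm
  have hgpos : ∀ γ : ℝ, ∀ x ∈ Ioc 0 a, 0 < x ^ (γ - 1) * f x := fun γ x hx =>
    mul_pos (Real.rpow_pos_of_pos hx.1 _) (hfpos x hx)
  have hgloc : ∀ γ x : ℝ, 0 < x → x ≤ a →
      IntegrableOn (fun s => s ^ (γ - 1) * f s) (Icc x a) := fun γ x hx hxa =>
    (hloc x hx hxa).continuousOn_mul (continuousOn_id.rpow_const fun s hs =>
      Or.inl (hx.trans_le hs.1).ne') isCompact_Icc
  have hfin : ∀ γ : ℝ, (∫⁻ s in Ioc (0 : ℝ) a, ENNReal.ofReal (s ^ (γ - 1) * f s)) < ⊤ ↔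
      IntegrableOn (fun s => s ^ (γ - 1) * f s) (Ioc 0 a) := by
    intro γ
    rw [IntegrableOn, Integrable, and_iff_right (hgm γ).aestronglyMeasurable,
      hasFiniteIntegral_iff_ofReal]
    exact (ae_restrict_iff' measurableSet_Ioc).2
      (Eventually.of_forall fun s hs => (hgpos γ s hs).le)
  have hlim : ∀ γ : ℝ, 0 < γ + α →
      (Tendsto (fun v => (1 / (v ^ γ * f v)) * ∫ s in Ioc (0 : ℝ) v, s ^ (γ - 1) * f s)
        (𝓝[>] 0) (𝓝 (1 / (γ + α))) ↔
      Tendsto (fun v => v * (v ^ (γ - 1) * f v) / ∫ s in 0..v, s ^ (γ - 1) * f s)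
        (𝓝[>] 0) (𝓝 (γ + α))) := by
    intro γ hγ
    rw [← tendsto_inv_iff₀ hγ.ne', ← one_div]
    refine tendsto_congr' ?_
    filter_upwards [self_mem_nhdsWithin] with v hv
    have hv : 0 < v := hv
    rw [intervalIntegral.integral_of_le hv.le, Real.rpow_sub_one hv.ne', ← mul_assoc,
      mul_div_cancel₀ _ hv.ne', inv_div, one_div_mul_eq_div]
  have hab : RegularlyVaryingAtZero f α → ∀ γ : ℝ, 0 < γ + α →
      (∫⁻ s in Ioc (0 : ℝ) a, ENNReal.ofReal (s ^ (γ - 1) * f s)) < ⊤ ∧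
      Tendsto (fun v => (1 / (v ^ γ * f v)) * ∫ s in Ioc (0 : ℝ) v, s ^ (γ - 1) * f s)
        (𝓝[>] 0) (𝓝 (1 / (γ + α))) := by
    intro h γ hγ
    have hg := h.rpow_mul (γ - 1)
    rw [sub_add_eq_add_sub] at hg
    have hi := hg.integrableOn_Ioc ha hγ (hgpos γ) (hgloc γ)
    exact ⟨(hfin γ).2 hi, (hlim γ hγ).2 (hg.tendsto_primitive ha hγ (hgm γ) (hgpos γ) hi)⟩
  have hca : (∃ γ : ℝ, 0 < γ + α ∧
      (∫⁻ s in Ioc (0 : ℝ) a, ENNReal.ofReal (s ^ (γ - 1) * f s)) < ⊤ ∧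
      Tendsto (fun v => (1 / (v ^ γ * f v)) * ∫ s in Ioc (0 : ℝ) v, s ^ (γ - 1) * f s)
        (𝓝[>] 0) (𝓝 (1 / (γ + α)))) → RegularlyVaryingAtZero f α := by
    rintro ⟨γ, hγ, hi, ht⟩
    have hg := (regularlyVaryingAtZero_of_tendsto ha hγ (hgpos γ) ((hfin γ).1 hi)
      ((hlim γ hγ).1 ht)).rpow_mul (-(γ - 1))
    rw [show -(γ - 1) + (γ + α - 1) = α by ring] at hg
    refine hg.congr_pos fun x hx => ?_
    rw [← mul_assoc, ← Real.rpow_add hx, neg_add_cancel, Real.rpow_zero, one_mul]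
  have hγ₀ : 0 < 1 - α + α := by linarith
  exact ⟨⟨hab, fun h => hca ⟨1 - α, hγ₀, h _ hγ₀⟩⟩, ⟨fun h => ⟨1 - α, hγ₀, hab h _ hγ₀⟩, hca⟩⟩
end

section
/- Let f and g be continuous, strictly increasing, unbounded functions from [a,+∞) to (0,∞) (so that f : [a,∞) → [f(a),∞) and g : [a,∞) → [g(a),∞) are bijections with increasing unbounded inverses f^{-1} and g^{-1}), and let f be regularly varying at +∞ with a nonzero index α. Then f ≈∼ g at +∞ if and only if f^{-1} ≈∼ g^{-1} at +∞. -/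
open Filter Set

/-- A function `g : [a,∞) → (0,∞)` is regularly varying at `+∞` with index `α` if
`g(λx)/g(x) → λ^α` as `x → +∞`, for every `λ > 0`. -/
def RegularlyVaryingAtTop (g : ℝ → ℝ) (α : ℝ) : Prop :=
  ∀ l : ℝ, 0 < l → Tendsto (fun x => g (l * x) / g x) atTop (nhds (l ^ α))

/-- `f ≈∼ g` at `+∞` (Definition A.9): there is an increasing sequence `xₙ ≥ a` with
`xₙ → +∞` and `f(xₙ)/g(xₙ) → 1`. -/
def AsympEquivOnSeqAtTop (f g : ℝ → ℝ) (a : ℝ) : Prop :=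
  ∃ x : ℕ → ℝ, StrictMono x ∧ (∀ n, a ≤ x n) ∧ Tendsto x atTop atTop ∧
    Tendsto (fun n => f (x n) / g (x n)) atTop (nhds 1)

section RegularVariation

variable {ι : Type*} {l : Filter ι} {f : ℝ → ℝ} {a α : ℝ} {x z : ι → ℝ}

lemma RegularlyVaryingAtTop.index_nonneg (hf : RegularlyVaryingAtTop f α)
    (hmono : StrictMonoOn f (Ici a)) (hpos : ∀ x, a ≤ x → 0 < f x) : 0 ≤ α := by
  have h1 : (1 : ℝ) ≤ 2 ^ α := by
    refine ge_of_tendsto (hf 2 two_pos) ?_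
    filter_upwards [eventually_ge_atTop a, eventually_ge_atTop 0] with x hxa hx0
    rw [le_div_iff₀ (hpos x hxa), one_mul]
    exact hmono.monotoneOn hxa (mem_Ici.2 (by linarith)) (by linarith)
  by_contra! h
  exact absurd (Real.rpow_lt_one_of_one_lt_of_neg one_lt_two h) (not_lt.2 h1)

lemma RegularlyVaryingAtTop.tendsto_comp_div_comp (hf : RegularlyVaryingAtTop f α)
    (hmono : StrictMonoOn f (Ici a)) (hpos : ∀ x, a ≤ x → 0 < f x)
    (hx : Tendsto x l atTop) (hz : ∀ᶠ i in l, a ≤ z i)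
    (h : Tendsto (fun i => z i / x i) l (nhds 1)) :
    Tendsto (fun i => f (z i) / f (x i)) l (nhds 1) := by
  have hcont : Tendsto (fun t : ℝ => t ^ α) (nhds 1) (nhds 1) := by
    simpa using (Real.continuousAt_rpow_const 1 α (Or.inl one_ne_zero)).tendsto
  refine tendsto_order.2 ⟨fun c hc => ?_, fun c hc => ?_⟩
  · obtain ⟨t, ⟨htc, ht0⟩, ht1⟩ :=
      ((((hcont.eventually (lt_mem_nhds hc)).and
        (lt_mem_nhds zero_lt_one)).filter_mono nhdsWithin_le_nhds).and
          (self_mem_nhdsWithin (s := Iio (1 : ℝ)))).exists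
    filter_upwards [((hf t ht0).comp hx).eventually (lt_mem_nhds htc),
      h.eventually (lt_mem_nhds ht1), hz, hx.eventually_ge_atTop a, hx.eventually_gt_atTop 0,
      (hx.const_mul_atTop ht0).eventually_ge_atTop a] with i h1 h2 h3 h4 h5 h6
    refine h1.trans_le (div_le_div_of_nonneg_right ?_ (hpos _ h4).le)
    exact hmono.monotoneOn h6 h3 ((lt_div_iff₀ h5).1 h2).le
  · obtain ⟨t, ⟨htc, ht0⟩, ht1⟩ :=
      ((((hcont.eventually (gt_mem_nhds hc)).and
        (lt_mem_nhds zero_lt_one)).filter_mono nhdsWithin_le_nhds).and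
          (self_mem_nhdsWithin (s := Ioi (1 : ℝ)))).exists
    filter_upwards [((hf t ht0).comp hx).eventually (gt_mem_nhds htc),
      h.eventually (gt_mem_nhds ht1), hz, hx.eventually_ge_atTop a, hx.eventually_gt_atTop 0,
      (hx.const_mul_atTop ht0).eventually_ge_atTop a] with i h1 h2 h3 h4 h5 h6
    refine (div_le_div_of_nonneg_right ?_ (hpos _ h4).le).trans_lt h1
    exact hmono.monotoneOn h3 h6 ((div_lt_iff₀ h5).1 h2).le

lemma RegularlyVaryingAtTop.tendsto_div_of_tendsto_comp_div_comp
    (hf : RegularlyVaryingAtTop f α) (hα : 0 < α)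
    (hmono : StrictMonoOn f (Ici a)) (hpos : ∀ x, a ≤ x → 0 < f x)
    (hx : Tendsto x l atTop) (hz : ∀ᶠ i in l, a ≤ z i)
    (h : Tendsto (fun i => f (z i) / f (x i)) l (nhds 1)) :
    Tendsto (fun i => z i / x i) l (nhds 1) := by
  refine tendsto_order.2 ⟨fun c hc => ?_, fun c hc => ?_⟩
  · obtain ⟨t, htc, ht1⟩ := exists_between (max_lt hc zero_lt_one)
    have ht0 : 0 < t := (le_max_right _ _).trans_lt htc
    obtain ⟨m, hm, hm1⟩ := exists_between (Real.rpow_lt_one ht0.le ht1 hα)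
    filter_upwards [((hf t ht0).comp hx).eventually (gt_mem_nhds hm),
      h.eventually (lt_mem_nhds hm1), hz, hx.eventually_ge_atTop a, hx.eventually_gt_atTop 0,
      (hx.const_mul_atTop ht0).eventually_ge_atTop a] with i h1 h2 h3 h4 h5 h6
    have hlt : f (t * x i) < f (z i) := (div_lt_div_iff_of_pos_right (hpos _ h4)).1 (h1.trans h2)
    exact ((le_max_left _ _).trans_lt htc).trans
      ((lt_div_iff₀ h5).2 ((hmono.lt_iff_lt h6 h3).1 hlt))
  · have hc0 : 0 < c := zero_lt_one.trans hc
    obtain ⟨m, hm1, hm⟩ := exists_between (Real.one_lt_rpow hc hα)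
    filter_upwards [((hf c hc0).comp hx).eventually (lt_mem_nhds hm),
      h.eventually (gt_mem_nhds hm1), hz, hx.eventually_ge_atTop a, hx.eventually_gt_atTop 0,
      (hx.const_mul_atTop hc0).eventually_ge_atTop a] with i h1 h2 h3 h4 h5 h6
    have hlt : f (z i) < f (c * x i) := (div_lt_div_iff_of_pos_right (hpos _ h4)).1 (h2.trans h1)
    exact (div_lt_iff₀ h5).2 ((hmono.lt_iff_lt h3 h6).1 hlt)

end RegularVariation

/-- **Theorem A.11(a).** If `f, g : [a,∞) → (0,∞)` are continuous, strictly increasing and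
unbounded, with (increasing, unbounded) inverses `f⁻¹ : [f(a),∞) → [a,∞)` and
`g⁻¹ : [g(a),∞) → [a,∞)`, and `f` is regularly varying at `+∞` with a nonzero index `α`,
then `f ≈∼ g` at `+∞` iff `f⁻¹ ≈∼ g⁻¹` at `+∞`. -/
theorem stmt_14 (a α : ℝ) (hα : α ≠ 0) (f g finv ginv : ℝ → ℝ)
    (hfc : ContinuousOn f (Ici a)) (hgc : ContinuousOn g (Ici a))
    (hfmono : StrictMonoOn f (Ici a)) (hgmono : StrictMonoOn g (Ici a))
    (hfpos : ∀ x, a ≤ x → 0 < f x) (hgpos : ∀ x, a ≤ x → 0 < g x)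
    (hftop : Tendsto f atTop atTop) (hgtop : Tendsto g atTop atTop)
    (hfinv₁ : ∀ x, a ≤ x → finv (f x) = x)
    (hfinv₂ : ∀ y, f a ≤ y → a ≤ finv y ∧ f (finv y) = y)
    (hginv₁ : ∀ x, a ≤ x → ginv (g x) = x)
    (hginv₂ : ∀ y, g a ≤ y → a ≤ ginv y ∧ g (ginv y) = y)
    (hfmeas : Measurable f)
    (hfRV : RegularlyVaryingAtTop f α) :
    AsympEquivOnSeqAtTop f g a ↔ AsympEquivOnSeqAtTop finv ginv (max (f a) (g a)) := by
  have hαpos : 0 < α := lt_of_le_of_ne (hfRV.index_nonneg hfmono hfpos) hα.symm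
  constructor
  · rintro ⟨x, hxmono, hxa, hxtop, hx⟩
    obtain ⟨N, hN⟩ := eventually_atTop.1 ((hgtop.comp hxtop).eventually_ge_atTop (f a))
    have hsh : Tendsto (fun n => n + N) atTop atTop := tendsto_add_atTop_nat N
    have hz : ∀ n, a ≤ finv (g (x (n + N))) ∧ f (finv (g (x (n + N)))) = g (x (n + N)) :=
      fun n => hfinv₂ _ (hN _ (Nat.le_add_left N n))
    refine ⟨fun n => g (x (n + N)), fun m n hmn => hgmono (hxa _) (hxa _) (hxmono (by lia)),
      fun n => max_le (hN _ (Nat.le_add_left N n))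
        (hgmono.monotoneOn self_mem_Ici (hxa _) (hxa _)),
      (hgtop.comp hxtop).comp hsh, ?_⟩
    simp only [hginv₁ _ (hxa _)]
    refine hfRV.tendsto_div_of_tendsto_comp_div_comp hαpos hfmono hfpos (hxtop.comp hsh)
      (Eventually.of_forall fun n => (hz n).1) ?_
    simpa [Function.comp_def, (hz _).2] using (hx.comp hsh).inv₀ one_ne_zero
  · rintro ⟨y, hymono, hya, hytop, hy⟩
    have hz := fun n => hfinv₂ (y n) ((le_max_left _ _).trans (hya n))
    have hx := fun n => hginv₂ (y n) ((le_max_right _ _).trans (hya n))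
    have hxtop : Tendsto (fun n => ginv (y n)) atTop atTop := by
      refine tendsto_atTop.2 fun M => ?_
      filter_upwards [hytop.eventually_ge_atTop (g (max M a))] with n hn
      rw [← (hx n).2, hgmono.le_iff_le (le_max_right M a) (hx n).1] at hn
      exact (le_max_left M a).trans hn
    refine ⟨fun n => ginv (y n), fun m n hmn => ?_, fun n => (hx n).1, hxtop, ?_⟩
    · rw [← hgmono.lt_iff_lt (hx m).1 (hx n).1, (hx m).2, (hx n).2]
      exact hymono hmn
    · have := (hfRV.tendsto_comp_div_comp hfmono hfpos hxtop
        (Eventually.of_forall fun n => (hz n).1) hy).inv₀ one_ne_zero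
      simpa [(hz _).2, (hx _).2] using this
end

section
/- Let f and g be continuous, strictly decreasing functions from [a,+∞) to (0,∞) with lim_{x→+∞} f(x) = lim_{x→+∞} g(x) = 0 (so that the inverses f^{-1} : (0,f(a)] → [a,∞) and g^{-1} : (0,g(a)] → [a,∞) are decreasing functions defined in a neighbourhood of 0₊), and let f be regularly varying at +∞ with a nonzero index α. Then f ≈∼ g at +∞ if and only if f^{-1} ≈∼ g^{-1} at 0₊. -/
open Filter Set

/-- `F ≈∼ G` at `0₊` (Definition A.9): there is a decreasing sequence `yₙ ∈ (0,c]` with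
`yₙ → 0` and `F(yₙ)/G(yₙ) → 1`. -/
def AsympEquivOnSeqAtZero (F G : ℝ → ℝ) (c : ℝ) : Prop :=
  ∃ y : ℕ → ℝ, StrictAnti y ∧ (∀ n, y n ∈ Set.Ioc 0 c) ∧ Tendsto y atTop (nhds 0) ∧
    Tendsto (fun n => F (y n) / G (y n)) atTop (nhds 1)

open Topology

/-- The index of a positive strictly decreasing regularly varying function is nonpositive. -/
lemma RegularlyVaryingAtTop.index_nonpos {f : ℝ → ℝ} {a α : ℝ}
    (hf : RegularlyVaryingAtTop f α) (hanti : StrictAntiOn f (Ici a))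
    (hpos : ∀ x, a ≤ x → 0 < f x) : α ≤ 0 := by
  have h : (2 : ℝ) ^ α ≤ 1 := by
    refine le_of_tendsto (hf 2 two_pos) ?_
    filter_upwards [eventually_ge_atTop a, eventually_gt_atTop 0] with x hx hx0
    rw [div_le_one (hpos x hx)]
    exact (hanti hx (mem_Ici.2 (by linarith)) (by linarith)).le
  by_contra! hα
  exact absurd h (not_le.2 (Real.one_lt_rpow one_lt_two hα))

/-- For a positive strictly decreasing regularly varying function of negative index,
asymptotically equal values force asymptotically equal arguments. -/
lemma RegularlyVaryingAtTop.tendsto_div_of_tendsto_apply_div {ι : Type*} {l : Filter ι}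
    {f : ℝ → ℝ} {a α : ℝ}
    (hf : RegularlyVaryingAtTop f α) (hanti : StrictAntiOn f (Ici a))
    (hpos : ∀ x, a ≤ x → 0 < f x) (hα : α < 0) {x z : ι → ℝ} (hx : Tendsto x l atTop)
    (hz : ∀ n, a ≤ z n) (h : Tendsto (fun n => f (z n) / f (x n)) l (𝓝 1)) :
    Tendsto (fun n => z n / x n) l (𝓝 1) := by
  refine tendsto_order.2 ⟨fun b hb => ?_, fun b hb => ?_⟩
  · obtain ⟨c, hc, hc1⟩ := exists_between (max_lt hb one_pos)
    have hc0 : 0 < c := (le_max_right _ _).trans_lt hc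
    filter_upwards [h.eventually_lt ((hf c hc0).comp hx)
      (Real.one_lt_rpow_of_pos_of_lt_one_of_neg hc0 hc1 hα), hx.eventually_ge_atTop a,
      hx.eventually_gt_atTop 0, (hx.const_mul_atTop hc0).eventually_ge_atTop a]
      with n hlt hxa hx0 hcx
    rw [lt_div_iff₀ hx0]
    have hlt' := (hanti.lt_iff_gt (hz n) hcx).1
      ((div_lt_div_iff_of_pos_right (hpos _ hxa)).1 hlt)
    exact (mul_le_mul_of_nonneg_right ((le_max_left _ _).trans hc.le) hx0.le).trans_lt hlt'
  · have hb0 : 0 < b := one_pos.trans hb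
    filter_upwards [((hf b hb0).comp hx).eventually_lt h
      (Real.rpow_lt_one_of_one_lt_of_neg hb hα), hx.eventually_ge_atTop a,
      hx.eventually_gt_atTop 0, (hx.const_mul_atTop hb0).eventually_ge_atTop a]
      with n hlt hxa hx0 hbx
    rw [div_lt_iff₀ hx0]
    exact (hanti.lt_iff_gt hbx (hz n)).1
      ((div_lt_div_iff_of_pos_right (hpos _ hxa)).1 hlt)

/-- A positive strictly decreasing regularly varying function takes asymptotically equal values
at asymptotically equal arguments. -/
lemma RegularlyVaryingAtTop.tendsto_apply_div_of_tendsto_div {ι : Type*} {l : Filter ι}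
    {f : ℝ → ℝ} {a α : ℝ}
    (hf : RegularlyVaryingAtTop f α) (hanti : StrictAntiOn f (Ici a))
    (hpos : ∀ x, a ≤ x → 0 < f x) {x z : ι → ℝ} (hx : Tendsto x l atTop)
    (hz : ∀ n, a ≤ z n) (h : Tendsto (fun n => z n / x n) l (𝓝 1)) :
    Tendsto (fun n => f (z n) / f (x n)) l (𝓝 1) := by
  have hcont : Tendsto (fun c : ℝ => c ^ α) (𝓝 1) (𝓝 1) := by
    simpa using (Real.continuousAt_rpow_const 1 α (Or.inl one_ne_zero)).tendsto
  refine tendsto_order.2 ⟨fun b hb => ?_, fun b hb => ?_⟩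
  · obtain ⟨c, hbc, hc⟩ := (((hcont.eventually (lt_mem_nhds hb)).filter_mono
      nhdsWithin_le_nhds).and (self_mem_nhdsWithin (s := Ioi (1 : ℝ)))).exists
    have hc0 : 0 < c := one_pos.trans hc
    filter_upwards [((hf c hc0).comp hx).eventually (lt_mem_nhds hbc),
      h.eventually (gt_mem_nhds hc), hx.eventually_ge_atTop a, hx.eventually_gt_atTop 0,
      (hx.const_mul_atTop hc0).eventually_ge_atTop a] with n hlt hzx hxa hx0 hcx
    rw [div_lt_iff₀ hx0] at hzx
    exact hlt.trans ((div_lt_div_iff_of_pos_right (hpos _ hxa)).2 (hanti (hz n) hcx hzx))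
  · obtain ⟨c, ⟨hbc, hc0⟩, hc⟩ := ((((hcont.eventually (gt_mem_nhds hb)).and
      (lt_mem_nhds one_pos)).filter_mono
      nhdsWithin_le_nhds).and (self_mem_nhdsWithin (s := Iio (1 : ℝ)))).exists
    filter_upwards [((hf c hc0).comp hx).eventually (gt_mem_nhds hbc),
      h.eventually (lt_mem_nhds hc), hx.eventually_ge_atTop a, hx.eventually_gt_atTop 0,
      (hx.const_mul_atTop hc0).eventually_ge_atTop a] with n hlt hzx hxa hx0 hcx
    rw [lt_div_iff₀ hx0] at hzx
    exact ((div_lt_div_iff_of_pos_right (hpos _ hxa)).2 (hanti hcx (hz n) hzx)).trans hlt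

/-- **Theorem A.11(b).** If `f, g : [a,∞) → (0,∞)` are continuous, strictly decreasing with
limit `0` at `+∞`, with (decreasing) inverses `f⁻¹ : (0,f(a)] → [a,∞)` and
`g⁻¹ : (0,g(a)] → [a,∞)` defined near `0₊`, and `f` is regularly varying at `+∞` with a
nonzero index `α`, then `f ≈∼ g` at `+∞` iff `f⁻¹ ≈∼ g⁻¹` at `0₊`. -/
theorem stmt_15 (a α : ℝ) (hα : α ≠ 0) (f g finv ginv : ℝ → ℝ)
    (hfc : ContinuousOn f (Ici a)) (hgc : ContinuousOn g (Ici a))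
    (hfanti : StrictAntiOn f (Ici a)) (hganti : StrictAntiOn g (Ici a))
    (hfpos : ∀ x, a ≤ x → 0 < f x) (hgpos : ∀ x, a ≤ x → 0 < g x)
    (hf0 : Tendsto f atTop (nhds 0)) (hg0 : Tendsto g atTop (nhds 0))
    (hfinv₁ : ∀ x, a ≤ x → finv (f x) = x)
    (hfinv₂ : ∀ y ∈ Set.Ioc (0 : ℝ) (f a), a ≤ finv y ∧ f (finv y) = y)
    (hginv₁ : ∀ x, a ≤ x → ginv (g x) = x)
    (hginv₂ : ∀ y ∈ Set.Ioc (0 : ℝ) (g a), a ≤ ginv y ∧ g (ginv y) = y)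
    (hfmeas : Measurable f)
    (hfRV : RegularlyVaryingAtTop f α) :
    AsympEquivOnSeqAtTop f g a ↔ AsympEquivOnSeqAtZero finv ginv (min (f a) (g a)) := by
  have hα' : α < 0 := lt_of_le_of_ne (hfRV.index_nonpos hfanti hfpos) hα
  constructor
  · rintro ⟨x, hxmono, hxa, hx, hlim⟩
    obtain ⟨N, hN⟩ := eventually_atTop.1
      ((hg0.comp hx).eventually (gt_mem_nhds (hfpos a le_rfl)))
    have hxN : Tendsto (fun n => x (n + N)) atTop atTop := hx.comp (tendsto_add_atTop_nat N)
    have hmem : ∀ n, g (x (n + N)) ∈ Ioc 0 (f a) := fun n =>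
      ⟨hgpos _ (hxa _), (hN (n + N) (Nat.le_add_left _ _)).le⟩
    refine ⟨fun n => g (x (n + N)), fun m n hmn => hganti (hxa _) (hxa _)
      (hxmono (Nat.add_lt_add_right hmn N)), fun n => ⟨(hmem n).1, le_min (hmem n).2
      (hganti.antitoneOn self_mem_Ici (hxa _) (hxa _))⟩, hg0.comp hxN, ?_⟩
    simp only [hginv₁ _ (hxa _)]
    refine hfRV.tendsto_div_of_tendsto_apply_div hfanti hfpos hα' hxN
      (fun n => (hfinv₂ _ (hmem n)).1) ?_
    simp only [(hfinv₂ _ (hmem _)).2]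
    simpa using (hlim.comp (tendsto_add_atTop_nat N)).inv₀ one_ne_zero
  · rintro ⟨y, hyanti, hy, hy0, hlim⟩
    have hyf := fun n => hfinv₂ (y n) ⟨(hy n).1, (hy n).2.trans (min_le_left _ _)⟩
    have hyg := fun n => hginv₂ (y n) ⟨(hy n).1, (hy n).2.trans (min_le_right _ _)⟩
    have hx : Tendsto (fun n => ginv (y n)) atTop atTop := by
      refine tendsto_atTop.2 fun M => ?_
      filter_upwards [hy0.eventually (gt_mem_nhds (hgpos (max M a) (le_max_right _ _)))]
        with n hn
      rw [← (hyg n).2, hganti.lt_iff_gt (hyg n).1 (mem_Ici.2 (le_max_right _ _))] at hn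
      exact (le_max_left _ _).trans hn.le
    refine ⟨fun n => ginv (y n), fun m n hmn => ?_, fun n => (hyg n).1, hx, ?_⟩
    · rw [← hganti.lt_iff_gt (hyg n).1 (hyg m).1, (hyg n).2, (hyg m).2]
      exact hyanti hmn
    · have h := (hfRV.tendsto_apply_div_of_tendsto_div hfanti hfpos hx
        (fun n => (hyf n).1) hlim).inv₀ one_ne_zero
      simp only [(hyf _).2, inv_div, inv_one] at h
      simpa only [(hyg _).2] using h
end

section
/- Let f and g be continuous, strictly decreasing, unbounded functions from (0,a] to (0,∞) with lim_{x↓0} f(x) = lim_{x↓0} g(x) = +∞ (so that the inverses f^{-1} and g^{-1} are decreasing functions defined in a neighbourhood of +∞), and let f be regularly varying at 0₊ with a nonzero index α. Then the following are equivalent: (1) there exist c > 0 and δ > 0 such that |f(x)/g(x) − 1| ≥ c for all x ∈ (0,δ); (2) there exist c′ > 0 and Y > 0 such that |f^{-1}(y)/g^{-1}(y) − 1| ≥ c′ for all y > Y. -/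
open Filter Set

namespace RegularlyVaryingAtZero

variable {a α : ℝ} {f : ℝ → ℝ}

/-- Eventual form of the defining limit on an explicit interval, together with the
membership of `l * z` in the domain. -/
theorem exists_forall_div_mem (hf : RegularlyVaryingAtZero f α) (ha : 0 < a) {l : ℝ} (hl : 0 < l)
    {s : Set ℝ} (hs : s ∈ nhds (l ^ α)) :
    ∃ η > 0, η ≤ a ∧ ∀ z ∈ Ioo 0 η, l * z ∈ Ioc 0 a ∧ f (l * z) / f z ∈ s := by
  obtain ⟨u, hu, h⟩ := mem_nhdsGT_iff_exists_Ioo_subset.1 ((hf l hl) hs)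
  have hu : 0 < u := hu
  refine ⟨min u (min a (a / l)), by positivity, by simp, fun z hz => ?_⟩
  obtain ⟨hz0, hz⟩ := hz
  simp only [lt_min_iff] at hz
  have hlz : z * l < a := (lt_div_iff₀ hl).1 hz.2.2
  exact ⟨⟨by positivity, by linarith⟩, h ⟨hz0, hz.1⟩⟩

/-- A strictly decreasing regularly varying function has nonpositive index. -/
theorem index_nonpos (hf : RegularlyVaryingAtZero f α) (ha : 0 < a)
    (hpos : ∀ x ∈ Ioc (0 : ℝ) a, 0 < f x) (hanti : StrictAntiOn f (Ioc 0 a)) : α ≤ 0 := by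
  by_contra! h
  have h2 : (1 : ℝ) < 2 ^ α := Real.one_lt_rpow (by norm_num) h
  obtain ⟨η, hη, hηa, H⟩ := hf.exists_forall_div_mem ha two_pos (Ioi_mem_nhds h2)
  obtain ⟨hm, hq⟩ := H (η / 2) ⟨by linarith, by linarith⟩
  have hz : η / 2 ∈ Ioc 0 a := ⟨by linarith, by linarith⟩
  have h3 := (one_lt_div (hpos _ hz)).1 hq
  linarith [hanti hz hm (by linarith)]

/-- Nearby arguments (in ratio) have nearby values (in ratio). -/
theorem abs_div_sub_one_lt (hf : RegularlyVaryingAtZero f α) (ha : 0 < a)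
    (hpos : ∀ x ∈ Ioc (0 : ℝ) a, 0 < f x) (hanti : StrictAntiOn f (Ioc 0 a))
    {c : ℝ} (hc : 0 < c) :
    ∃ ε > 0, ∃ η > 0, η ≤ a ∧ ∀ x ∈ Ioo 0 η, ∀ z ∈ Ioo 0 η,
      |x / z - 1| < ε → |f z / f x - 1| < c := by
  obtain ⟨d, hd0, hd1, hdc⟩ : ∃ d : ℝ, 0 < d ∧ d < 1 ∧ d ≤ c :=
    ⟨min c (1 / 2), by positivity, (min_le_right _ _).trans_lt (by norm_num), min_le_left _ _⟩
  have hlow : (1 + d)⁻¹ < 1 := inv_lt_one_of_one_lt₀ (by linarith)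
  have hupp : 1 < (1 - d)⁻¹ := (one_lt_inv₀ (by linarith)).2 (by linarith)
  have hcont : Tendsto (fun l : ℝ => l ^ α) (nhds 1) (nhds 1) := by
    simpa using (Real.continuousAt_rpow_const 1 α (Or.inl one_ne_zero)).tendsto
  obtain ⟨e, he, hball⟩ := Metric.eventually_nhds_iff.1
    (hcont.eventually (Ioo_mem_nhds hlow hupp))
  obtain ⟨ε, hε0, hε1, hεe⟩ : ∃ ε : ℝ, 0 < ε ∧ ε < 1 ∧ ε < e :=
    ⟨min e 1 / 2, by positivity, by linarith [min_le_right e 1],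
      by linarith [min_le_left e 1, lt_min he one_pos]⟩
  have hplus := (hball (y := 1 + ε) (by simpa [Real.dist_eq, abs_of_pos hε0] using hεe)).1
  have hminus := (hball (y := 1 - ε) (by simpa [Real.dist_eq, abs_of_pos hε0] using hεe)).2
  obtain ⟨η₁, hη₁, hη₁a, H₁⟩ := hf.exists_forall_div_mem ha (by linarith) (Ioi_mem_nhds hplus)
  obtain ⟨η₂, hη₂, hη₂a, H₂⟩ := hf.exists_forall_div_mem ha (by linarith) (Iio_mem_nhds hminus)
  refine ⟨ε, hε0, min η₁ η₂, by positivity, (min_le_left _ _).trans hη₁a,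
    fun x hx z hz hxz => ?_⟩
  obtain ⟨hm₁, hq₁⟩ := H₁ z ⟨hz.1, hz.2.trans_le (min_le_left _ _)⟩
  obtain ⟨hm₂, hq₂⟩ := H₂ z ⟨hz.1, hz.2.trans_le (min_le_right _ _)⟩
  have hxa : x ∈ Ioc 0 a := ⟨hx.1, by linarith [hx.2, min_le_left η₁ η₂]⟩
  have hza : z ∈ Ioc 0 a := ⟨hz.1, by linarith [hz.2, min_le_left η₁ η₂]⟩
  have hfx := hpos x hxa
  have hfz := hpos z hza
  obtain ⟨hl, hr⟩ := abs_lt.1 hxz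
  have hx₁ : x < (1 + ε) * z := (div_lt_iff₀ hz.1).1 (by linarith)
  have hx₂ : (1 - ε) * z < x := (lt_div_iff₀ hz.1).1 (by linarith)
  have hf₁ := hanti hxa hm₁ hx₁
  have hf₂ := hanti hm₂ hxa hx₂
  have hq₁ := (lt_div_iff₀ hfz).1 (mem_Ioi.1 hq₁)
  have hq₂ := (div_lt_iff₀ hfz).1 (mem_Iio.1 hq₂)
  rw [inv_mul_lt_iff₀ (by linarith)] at hq₁
  rw [lt_inv_mul_iff₀ (by linarith)] at hq₂
  have hu : f z / f x < 1 + d := (div_lt_iff₀ hfx).2 (by nlinarith)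
  have hv : 1 - d < f z / f x := (lt_div_iff₀ hfx).2 (by nlinarith)
  exact abs_lt.2 ⟨by linarith, by linarith⟩

/-- For a negative index, nearby values (in ratio) come from nearby arguments (in ratio). -/
theorem abs_div_sub_one_lt_of_index_neg (hf : RegularlyVaryingAtZero f α) (ha : 0 < a)
    (hα : α < 0) (hpos : ∀ x ∈ Ioc (0 : ℝ) a, 0 < f x) (hanti : StrictAntiOn f (Ioc 0 a))
    {c : ℝ} (hc : 0 < c) :
    ∃ ε > 0, ∃ η > 0, η ≤ a ∧ ∀ x ∈ Ioo 0 η, ∀ z ∈ Ioo 0 η,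
      |f z / f x - 1| < ε → |x / z - 1| < c := by
  obtain ⟨d, hd0, hd1, hdc⟩ : ∃ d : ℝ, 0 < d ∧ d < 1 ∧ d ≤ c :=
    ⟨min c (1 / 2), by positivity, (min_le_right _ _).trans_lt (by norm_num), min_le_left _ _⟩
  have hplus : (1 + d) ^ α < 1 := Real.rpow_lt_one_of_one_lt_of_neg (by linarith) hα
  have hminus : 1 < (1 - d) ^ α :=
    Real.one_lt_rpow_of_pos_of_lt_one_of_neg (by linarith) (by linarith) hα
  have hcont : Tendsto (fun l : ℝ => l⁻¹) (nhds 1) (nhds 1) := by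
    simpa using tendsto_inv₀ (one_ne_zero (α := ℝ))
  obtain ⟨e, he, hball⟩ := Metric.eventually_nhds_iff.1
    (hcont.eventually (Ioo_mem_nhds hplus hminus))
  obtain ⟨ε, hε0, hε1, hεe⟩ : ∃ ε : ℝ, 0 < ε ∧ ε < 1 ∧ ε < e :=
    ⟨min e 1 / 2, by positivity, by linarith [min_le_right e 1],
      by linarith [min_le_left e 1, lt_min he one_pos]⟩
  have hplus := (hball (y := 1 + ε) (by simpa [Real.dist_eq, abs_of_pos hε0] using hεe)).1
  have hminus := (hball (y := 1 - ε) (by simpa [Real.dist_eq, abs_of_pos hε0] using hεe)).2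
  obtain ⟨η₁, hη₁, hη₁a, H₁⟩ := hf.exists_forall_div_mem ha (by linarith) (Iio_mem_nhds hplus)
  obtain ⟨η₂, hη₂, hη₂a, H₂⟩ := hf.exists_forall_div_mem ha (by linarith) (Ioi_mem_nhds hminus)
  refine ⟨ε, hε0, min η₁ η₂, by positivity, (min_le_left _ _).trans hη₁a,
    fun x hx z hz hxz => ?_⟩
  obtain ⟨hm₁, hq₁⟩ := H₁ z ⟨hz.1, hz.2.trans_le (min_le_left _ _)⟩
  obtain ⟨hm₂, hq₂⟩ := H₂ z ⟨hz.1, hz.2.trans_le (min_le_right _ _)⟩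
  have hxa : x ∈ Ioc 0 a := ⟨hx.1, by linarith [hx.2, min_le_left η₁ η₂]⟩
  have hza : z ∈ Ioc 0 a := ⟨hz.1, by linarith [hz.2, min_le_left η₁ η₂]⟩
  have hfx := hpos x hxa
  have hfz := hpos z hza
  obtain ⟨hl, hr⟩ := abs_lt.1 hxz
  have hl : (1 - ε) * f x < f z := (lt_div_iff₀ hfx).1 (by linarith)
  have hr : f z < (1 + ε) * f x := (div_lt_iff₀ hfx).1 (by linarith)
  have hq₁ := (div_lt_iff₀ hfz).1 (mem_Iio.1 hq₁)
  have hq₂ := (lt_div_iff₀ hfz).1 (mem_Ioi.1 hq₂)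
  rw [lt_inv_mul_iff₀ (by linarith)] at hq₁
  rw [inv_mul_lt_iff₀ (by linarith)] at hq₂
  have hx₁ : x < (1 + d) * z := (hanti.lt_iff_gt hm₁ hxa).1 (by nlinarith)
  have hx₂ : (1 - d) * z < x := (hanti.lt_iff_gt hxa hm₂).1 (by nlinarith)
  have hu : x / z < 1 + d := (div_lt_iff₀ hz.1).2 hx₁
  have hv : 1 - d < x / z := (lt_div_iff₀ hz.1).2 hx₂
  exact abs_lt.2 ⟨by linarith, by linarith⟩

end RegularlyVaryingAtZero

/-- **Corollary A.13.** Let `f, g : (0,a] → (0,∞)` be continuous, strictly decreasing and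
unbounded at `0₊`, with (decreasing) inverses `f⁻¹, g⁻¹` defined in a neighbourhood of
`+∞`, and let `f` be regularly varying at `0₊` with a nonzero index `α`. Then
`(f/g - 1)⁻¹ = O(1)` as `x ↓ 0` iff `(f⁻¹/g⁻¹ - 1)⁻¹ = O(1)` as `y → +∞`. -/
theorem stmt_17 (a α : ℝ) (ha : 0 < a) (hα : α ≠ 0) (f g finv ginv : ℝ → ℝ)
    (hfc : ContinuousOn f (Ioc 0 a)) (hgc : ContinuousOn g (Ioc 0 a))
    (hfpos : ∀ x ∈ Ioc (0 : ℝ) a, 0 < f x) (hgpos : ∀ x ∈ Ioc (0 : ℝ) a, 0 < g x)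
    (hfanti : StrictAntiOn f (Ioc 0 a)) (hganti : StrictAntiOn g (Ioc 0 a))
    (hftop : Tendsto f (nhdsWithin 0 (Ioi 0)) atTop)
    (hgtop : Tendsto g (nhdsWithin 0 (Ioi 0)) atTop)
    (hfinv₁ : ∀ x ∈ Ioc (0 : ℝ) a, finv (f x) = x)
    (hfinv₂ : ∀ y, f a ≤ y → finv y ∈ Ioc 0 a ∧ f (finv y) = y)
    (hginv₁ : ∀ x ∈ Ioc (0 : ℝ) a, ginv (g x) = x)
    (hginv₂ : ∀ y, g a ≤ y → ginv y ∈ Ioc 0 a ∧ g (ginv y) = y)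
    (hfmeas : Measurable f)
    (hfRV : RegularlyVaryingAtZero f α) :
    (∃ c > (0 : ℝ), ∃ δ > (0 : ℝ), δ ≤ a ∧ ∀ x ∈ Ioo (0 : ℝ) δ, c ≤ |f x / g x - 1|) ↔
      (∃ c' > (0 : ℝ), ∃ Y : ℝ, max (f a) (g a) ≤ Y ∧
        ∀ y > Y, c' ≤ |finv y / ginv y - 1|) := by
  constructor
  · rintro ⟨c, hc, δ, hδ, hδa, H⟩
    obtain ⟨ε, hε, η, hη, hηa, K⟩ := hfRV.abs_div_sub_one_lt ha hfpos hfanti hc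
    have hm : min δ η ∈ Ioc 0 a := ⟨by positivity, (min_le_left _ _).trans hδa⟩
    refine ⟨ε, hε, max (f (min δ η)) (g (min δ η)), max_le_max ?_ ?_, fun y hy => ?_⟩
    · exact hfanti.antitoneOn hm ⟨ha, le_rfl⟩ hm.2
    · exact hganti.antitoneOn hm ⟨ha, le_rfl⟩ hm.2
    obtain ⟨hyf, hyg⟩ := max_lt_iff.1 hy
    obtain ⟨hx, hfx⟩ := hfinv₂ y ((hfanti.antitoneOn hm ⟨ha, le_rfl⟩ hm.2).trans hyf.le)
    obtain ⟨hz, hgz⟩ := hginv₂ y ((hganti.antitoneOn hm ⟨ha, le_rfl⟩ hm.2).trans hyg.le)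
    have hxm : finv y < min δ η := (hfanti.lt_iff_gt hm hx).1 (hfx.symm ▸ hyf)
    have hzm : ginv y < min δ η := (hganti.lt_iff_gt hm hz).1 (hgz.symm ▸ hyg)
    by_contra! hlt
    have h1 := K _ ⟨hx.1, hxm.trans_le (min_le_right _ _)⟩ _
      ⟨hz.1, hzm.trans_le (min_le_right _ _)⟩ hlt
    have h2 := H _ ⟨hz.1, hzm.trans_le (min_le_left _ _)⟩
    rw [hgz] at h2
    rw [hfx] at h1
    exact absurd h1 h2.not_gt
  · rintro ⟨c, hc, Y, hY, H⟩
    have hα' : α < 0 := lt_of_le_of_ne (hfRV.index_nonpos ha hfpos hfanti) hα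
    obtain ⟨ε, hε, η, hη, hηa, K⟩ :=
      hfRV.abs_div_sub_one_lt_of_index_neg ha hα' hfpos hfanti hc
    have hm : η ∈ Ioc 0 a := ⟨hη, hηa⟩
    obtain ⟨u, hu, hgu⟩ := mem_nhdsGT_iff_exists_Ioo_subset.1
      (hgtop.eventually_gt_atTop (max Y (f η)))
    have hu : 0 < u := hu
    refine ⟨ε, hε, min u η, by positivity, (min_le_right _ _).trans hηa, fun z hz => ?_⟩
    have hzη : z < η := hz.2.trans_le (min_le_right _ _)
    have hgz : max Y (f η) < g z := hgu ⟨hz.1, hz.2.trans_le (min_le_left _ _)⟩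
    obtain ⟨hyY, hyf⟩ := max_lt_iff.1 hgz
    obtain ⟨hx, hfx⟩ := hfinv₂ (g z) (((le_max_left _ _).trans hY).trans hyY.le)
    have hxm : finv (g z) < η := (hfanti.lt_iff_gt hm hx).1 (hfx.symm ▸ hyf)
    have h2 := H _ hyY
    rw [hginv₁ z ⟨hz.1, by linarith⟩] at h2
    by_contra! hlt
    exact absurd (K _ ⟨hx.1, hxm⟩ z ⟨hz.1, hzη⟩ (hfx.symm ▸ hlt)) h2.not_gt
end

section
/- For x ≥ e set ln₂ x = ln(ln x), and define f(x) = exp(ln₂ x + sin(ln₂ x)) and g(x) = exp(ln₂ x − sin(ln₂ x)) on [e,+∞). Then: (i) f and g are nondecreasing, unbounded, and slowly varying at +∞, and so is the ratio f/g = exp(2 sin(ln₂ x)); (ii) for xₙ = exp(exp(nπ)) one has f(xₙ)/g(xₙ) = 1 for every n ∈ ℕ, so f ≈∼ g at +∞; (iii) it is not true that f(x)/g(x) → 1 as x → +∞ (indeed f(yₙ)/g(yₙ) = e² for yₙ = x_{2n−1}^{exp(−π/2)}), so f ∼ g at +∞ fails. -/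
open Filter Set

/-- `ln₂ x = ln (ln x)`. -/
noncomputable def lnln (x : ℝ) : ℝ := Real.log (Real.log x)

/-- `f(x) = exp(ln₂ x + sin(ln₂ x))` of Example A.14. -/
noncomputable def fEx (x : ℝ) : ℝ := Real.exp (lnln x + Real.sin (lnln x))

/-- `g(x) = exp(ln₂ x − sin(ln₂ x))` of Example A.14. -/
noncomputable def gEx (x : ℝ) : ℝ := Real.exp (lnln x - Real.sin (lnln x))

/-- The sequence `xₙ = exp(exp(nπ))` of Example A.14. -/
noncomputable def xEx (n : ℕ) : ℝ := Real.exp (Real.exp (n * Real.pi))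

/-- A function `h : [a,∞) → (0,∞)` is slowly varying at `+∞` if `h(λx)/h(x) → 1` as
`x → +∞`, for every `λ > 0`. -/
def SlowlyVaryingAtTop (h : ℝ → ℝ) : Prop :=
  ∀ l : ℝ, 0 < l → Tendsto (fun x => h (l * x) / h x) atTop (nhds 1)

theorem monotone_add_sin : Monotone fun t : ℝ => t + Real.sin t := by
  intro s t hst
  have h := Real.abs_sin_sub_sin_le s t
  rw [abs_of_nonpos (sub_nonpos.2 hst)] at h
  have := (abs_le.1 h).2
  dsimp only
  linarith

theorem monotone_sub_sin : Monotone fun t : ℝ => t - Real.sin t := by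
  intro s t hst
  have h := Real.abs_sin_sub_sin_le s t
  rw [abs_of_nonpos (sub_nonpos.2 hst)] at h
  have := (abs_le.1 h).1
  dsimp only
  linarith

theorem monotoneOn_lnln : MonotoneOn lnln (Ici (Real.exp 1)) := by
  intro x hx y _ hxy
  have hx0 : 0 < x := (Real.exp_pos 1).trans_le hx
  have hlog : 1 ≤ Real.log x := (Real.le_log_iff_exp_le hx0).2 hx
  exact Real.log_le_log (by linarith) (Real.log_le_log hx0 hxy)

theorem tendsto_lnln_atTop : Tendsto lnln atTop atTop :=
  Real.tendsto_log_atTop.comp Real.tendsto_log_atTop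

theorem tendsto_lnln_mul_sub_lnln {l : ℝ} (hl : 0 < l) :
    Tendsto (fun x => lnln (l * x) - lnln x) atTop (nhds 0) := by
  have hratio : Tendsto (fun x => 1 + Real.log l / Real.log x) atTop (nhds 1) := by
    simpa using (Real.tendsto_log_atTop.const_div_atTop (Real.log l)).const_add 1
  have hlog := hratio.log one_ne_zero
  rw [Real.log_one] at hlog
  refine hlog.congr' ?_
  filter_upwards [eventually_gt_atTop 0, Real.tendsto_log_atTop.eventually_gt_atTop 0,
    Real.tendsto_log_atTop.eventually_gt_atTop (-Real.log l)] with x hx hlx hlx'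
  have hmul : Real.log (l * x) = Real.log l + Real.log x := Real.log_mul hl.ne' hx.ne'
  have hne : Real.log (l * x) ≠ 0 := by rw [hmul]; linarith
  rw [lnln, lnln, ← Real.log_div hne hlx.ne', hmul]
  congr 1
  field_simp
  ring

theorem slowlyVaryingAtTop_exp_comp_lnln {φ : ℝ → ℝ} (hφ : UniformContinuous φ) :
    SlowlyVaryingAtTop fun x => Real.exp (φ (lnln x)) := by
  intro l hl
  have hdiff : Tendsto (fun x => φ (lnln (l * x)) - φ (lnln x)) atTop (nhds 0) := by
    rw [Metric.tendsto_nhds]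
    intro ε hε
    obtain ⟨δ, hδ, h⟩ := Metric.uniformContinuous_iff.1 hφ ε hε
    filter_upwards [Metric.tendsto_nhds.1 (tendsto_lnln_mul_sub_lnln hl) δ hδ] with x hx
    rw [dist_zero_right, ← dist_eq_norm] at hx ⊢
    exact h hx
  simpa [Real.exp_sub] using hdiff.rexp

theorem fEx_div_gEx (x : ℝ) : fEx x / gEx x = Real.exp (2 * Real.sin (lnln x)) := by
  rw [fEx, gEx, ← Real.exp_sub]
  congr 1
  ring

theorem lnln_exp_exp (t : ℝ) : lnln (Real.exp (Real.exp t)) = t := by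
  simp [lnln]

theorem fEx_div_gEx_xEx (n : ℕ) : fEx (xEx n) / gEx (xEx n) = 1 := by
  rw [fEx_div_gEx, xEx, lnln_exp_exp, Real.sin_nat_mul_pi, mul_zero, Real.exp_zero]

theorem strictMono_xEx : StrictMono xEx := fun _ _ h =>
  Real.exp_strictMono <| Real.exp_strictMono <|
    mul_lt_mul_of_pos_right (Nat.cast_lt.2 h) Real.pi_pos

theorem tendsto_xEx_atTop : Tendsto xEx atTop atTop :=
  Real.tendsto_exp_atTop.comp <| Real.tendsto_exp_atTop.comp <|
    tendsto_natCast_atTop_atTop.atTop_mul_const Real.pi_pos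

theorem exp_one_le_xEx (n : ℕ) : Real.exp 1 ≤ xEx n :=
  Real.exp_le_exp.2 <| Real.one_le_exp <| by positivity

theorem xEx_rpow (n : ℕ) (t : ℝ) :
    xEx n ^ Real.exp t = Real.exp (Real.exp (n * Real.pi + t)) := by
  rw [xEx, ← Real.exp_mul, ← Real.exp_add]

theorem fEx_div_gEx_exp_exp (t : ℝ) :
    fEx (Real.exp (Real.exp t)) / gEx (Real.exp (Real.exp t)) = Real.exp (2 * Real.sin t) := by
  rw [fEx_div_gEx, lnln_exp_exp]

theorem fEx_div_gEx_xEx_rpow {n : ℕ} (hn : 1 ≤ n) :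
    fEx (xEx (2 * n - 1) ^ Real.exp (-(Real.pi / 2))) /
      gEx (xEx (2 * n - 1) ^ Real.exp (-(Real.pi / 2))) = Real.exp 2 := by
  obtain ⟨m, rfl⟩ := Nat.exists_eq_add_of_le' hn
  have harg : ((2 * (m + 1) - 1 : ℕ) : ℝ) * Real.pi + -(Real.pi / 2) =
      Real.pi / 2 + m * (2 * Real.pi) := by
    rw [show 2 * (m + 1) - 1 = 2 * m + 1 by omega]
    push_cast
    ring
  rw [xEx_rpow, fEx_div_gEx_exp_exp, harg, Real.sin_add_nat_mul_two_pi, Real.sin_pi_div_two,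
    mul_one]

theorem tendsto_xEx_rpow_atTop :
    Tendsto (fun n : ℕ => xEx (2 * n - 1) ^ Real.exp (-(Real.pi / 2))) atTop atTop := by
  refine (tendsto_rpow_atTop (Real.exp_pos _)).comp (tendsto_xEx_atTop.comp ?_)
  exact tendsto_atTop_mono (fun n => show n - 1 ≤ 2 * n - 1 by omega) (tendsto_sub_atTop_nat 1)

theorem not_tendsto_fEx_div_gEx : ¬ Tendsto (fun x => fEx x / gEx x) atTop (nhds 1) := by
  intro h
  have hconst : Tendsto (fun _ : ℕ => Real.exp 2) atTop (nhds 1) := by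
    refine (h.comp tendsto_xEx_rpow_atTop).congr' ?_
    filter_upwards [eventually_ge_atTop 1] with n hn
    exact fEx_div_gEx_xEx_rpow hn
  have heq := tendsto_nhds_unique tendsto_const_nhds hconst
  rw [Real.exp_eq_one_iff] at heq
  norm_num at heq

/-- **Example A.14.** For `f(x) = exp(ln₂ x + sin(ln₂ x))` and
`g(x) = exp(ln₂ x − sin(ln₂ x))` on `[e,∞)`:
(i) `f`, `g` are nondecreasing, unbounded and slowly varying at `+∞`, and so is the ratio
`f/g = exp(2 sin(ln₂ x))`;
(ii) `f(xₙ)/g(xₙ) = 1` for `xₙ = exp(exp(nπ))`, hence `f ≈∼ g` at `+∞`;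
(iii) `f(x)/g(x) → 1` as `x → +∞` fails; indeed `f(yₙ)/g(yₙ) = e²` for
`yₙ = x_{2n-1}^{exp(-π/2)}`. -/
theorem stmt_19 :
    (MonotoneOn fEx (Ici (Real.exp 1)) ∧ MonotoneOn gEx (Ici (Real.exp 1)) ∧
      Tendsto fEx atTop atTop ∧ Tendsto gEx atTop atTop ∧
      SlowlyVaryingAtTop fEx ∧ SlowlyVaryingAtTop gEx ∧
      SlowlyVaryingAtTop (fun x => fEx x / gEx x) ∧
      (∀ x : ℝ, Real.exp 1 ≤ x → fEx x / gEx x = Real.exp (2 * Real.sin (lnln x)))) ∧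
    ((∀ n : ℕ, fEx (xEx n) / gEx (xEx n) = 1) ∧
      AsympEquivOnSeqAtTop fEx gEx (Real.exp 1)) ∧
    (¬ Tendsto (fun x => fEx x / gEx x) atTop (nhds 1) ∧
      ∀ n : ℕ, 1 ≤ n →
        fEx (xEx (2 * n - 1) ^ Real.exp (-(Real.pi / 2))) /
            gEx (xEx (2 * n - 1) ^ Real.exp (-(Real.pi / 2))) = Real.exp 2) := by
  refine ⟨⟨?_, ?_, ?_, ?_, ?_, ?_, ?_, fun x _ => fEx_div_gEx x⟩,
    ⟨fEx_div_gEx_xEx, xEx, strictMono_xEx, exp_one_le_xEx, tendsto_xEx_atTop, ?_⟩,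
    not_tendsto_fEx_div_gEx, fun n hn => fEx_div_gEx_xEx_rpow hn⟩
  · exact (Real.exp_monotone.comp monotone_add_sin).comp_monotoneOn monotoneOn_lnln
  · exact (Real.exp_monotone.comp monotone_sub_sin).comp_monotoneOn monotoneOn_lnln
  · exact Real.tendsto_exp_atTop.comp <|
      tendsto_atTop_add_right_of_le _ (-1) tendsto_lnln_atTop fun x => Real.neg_one_le_sin _
  · refine Real.tendsto_exp_atTop.comp ?_
    simp only [sub_eq_add_neg]
    exact tendsto_atTop_add_right_of_le _ (-1) tendsto_lnln_atTop
      fun x => neg_le_neg (Real.sin_le_one _)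
  · exact slowlyVaryingAtTop_exp_comp_lnln
      (uniformContinuous_id.add Real.lipschitzWith_sin.uniformContinuous)
  · exact slowlyVaryingAtTop_exp_comp_lnln
      (uniformContinuous_id.sub Real.lipschitzWith_sin.uniformContinuous)
  · simp only [fEx_div_gEx]
    exact slowlyVaryingAtTop_exp_comp_lnln (Real.lipschitzWith_sin.uniformContinuous.const_mul' 2)
  · simp only [fEx_div_gEx_xEx, tendsto_const_nhds]
end
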